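/- Let A = kQ/I be a non simply connected toupie algebra with m = dim_k e_0 A e_∞ = 1 such that some branch of Q lies in the ideal I. Then A is not weakly shod. -/

import Mathlib

/-!
Formalization preamble for "Toupie algebras".

We realize the bound quiver algebra `A = kQ/I` of a toupie quiver `Q` concretely:
the path algebra `kQ` is realized, via its (faithful) left regular representation,
as the subalgebra of `Module.End k (paths → k)` generated by the operators of left
multiplication by the trivial paths `e_v` and by the arrows of `Q`.  Paths are
composed from left to right (`p * q` = "first `p`, then `q`"), as in
Assem–Simson–Skowroński, so that paths from the source `0` to the sink `∞` span
`e₀ (kQ) e∞`, and (right) `A`-modules are identified with representations of `(Q, I)`.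
Right `A`-modules are formalized as (left) modules over `Aᵐᵒᵖ`.
-/

set_option synthInstance.maxHeartbeats 400000
set_option maxHeartbeats 800000

noncomputable section
open scoped Classical
open MulOpposite

universe u

namespace Toupie

/-- Vertices of a toupie quiver with `t` branches, branch `i` having length `ℓ i ≥ 1`:
the unique source `src`, the unique sink `snk`, and for each branch `i` its interior
vertices `mid i a` (the `(a+1)`-st vertex on branch `i`, for `a : Fin (ℓ i - 1)`). -/
inductive Vtx (t : ℕ) (ℓ : Fin t → ℕ) : Type
  | src : Vtx t ℓ
  | snk : Vtx t ℓ
  | mid (i : Fin t) (a : Fin (ℓ i - 1)) : Vtx t ℓ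

/-- The `a`-th vertex on branch `i`, for `0 ≤ a ≤ ℓ i`
(`a = 0` is the source, `a = ℓ i` is the sink). -/
def vtx (t : ℕ) (ℓ : Fin t → ℕ) (i : Fin t) (a : ℕ) : Vtx t ℓ :=
  if a = 0 then .src else if h : a - 1 < ℓ i - 1 then .mid i ⟨a - 1, h⟩ else .snk

/-- The paths of a toupie quiver: trivial paths at the vertices, and for each branch
`i` and `a < b ≤ ℓ i` the path `sub i a b` along branch `i` from its `a`-th vertex to
its `b`-th vertex.  (`sub i 0 (ℓ i)` is the `i`-th branch `w i`.) -/
inductive PIdx (t : ℕ) (ℓ : Fin t → ℕ) : Type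
  | vert (v : Vtx t ℓ) : PIdx t ℓ
  | sub (i : Fin t) (a b : ℕ) (hab : a < b) (hb : b ≤ ℓ i) : PIdx t ℓ

variable (k : Type u) [Field k] (t : ℕ) (ℓ : Fin t → ℕ)

/-- The vector space with basis the set of paths of the toupie quiver. -/
abbrev PSp : Type u := PIdx t ℓ → k

variable {t ℓ}

/-- The starting vertex of a path. -/
def startIdx : PIdx t ℓ → Vtx t ℓ
  | .vert v => v
  | .sub i a _ _ _ => vtx t ℓ i a

/-- Left multiplication by the trivial path (primitive idempotent) `e_v`. -/
def Ev (v : Vtx t ℓ) : Module.End k (PSp k t ℓ) where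
  toFun f := fun p => if startIdx p = v then f p else 0
  map_add' f g := by funext p; by_cases h : startIdx p = v <;> simp [h]
  map_smul' c f := by funext p; by_cases h : startIdx p = v <;> simp [h]

/-- Strip the `j`-th arrow of branch `i` (the arrow `vtx i j ⟶ vtx i (j+1)`) from the
front of a path, if possible. -/
def strip (i : Fin t) (j : ℕ) : PIdx t ℓ → Option (PIdx t ℓ)
  | .vert _ => none
  | .sub i' a b _ hb =>
      if h : i' = i ∧ a = j then
        if hb2 : j + 1 < b then some (.sub i (j + 1) b hb2 (h.1 ▸ hb))
        else some (.vert (vtx t ℓ i b))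
      else none

/-- Left multiplication by the `j`-th arrow of branch `i`
(the arrow from `vtx i j` to `vtx i (j+1)`, for `j < ℓ i`; the zero operator for junk `j`). -/
def Ar (i : Fin t) (j : ℕ) : Module.End k (PSp k t ℓ) where
  toFun f := fun p => (strip i j p).elim 0 f
  map_add' f g := by funext p; rcases h : strip i j p with _ | q <;> simp [h]
  map_smul' c f := by funext p; rcases h : strip i j p with _ | q <;> simp [h]

variable (t ℓ)

/-- The generators of the path algebra: the trivial paths and the arrows. -/
def gens : Set (Module.End k (PSp k t ℓ)) :=
  Set.range (Ev k) ∪ {x | ∃ i j, x = Ar k i j}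

/-- The path algebra `kQ` of the toupie quiver, realized as the subalgebra of
`Module.End k (PSp k t ℓ)` generated by left multiplication by trivial paths and arrows. -/
def PathAlg : Subalgebra k (Module.End k (PSp k t ℓ)) :=
  Algebra.adjoin k (gens k t ℓ)

variable {k t ℓ}

/-- The trivial path `e_v` as an element of the path algebra. -/
def eV (v : Vtx t ℓ) : PathAlg k t ℓ :=
  ⟨Ev k v, Algebra.subset_adjoin (Or.inl ⟨v, rfl⟩)⟩

/-- The `j`-th arrow of branch `i` as an element of the path algebra. -/
def arE (i : Fin t) (j : ℕ) : PathAlg k t ℓ :=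
  ⟨Ar k i j, Algebra.subset_adjoin (Or.inr ⟨i, j, rfl⟩)⟩

/-- The path along branch `i` from its `a`-th vertex to its `b`-th vertex, as an element
of the path algebra: the product (composed from left to right) of the arrows
`a → a+1 → ⋯ → b`.  (For `b ≤ a` this is the empty product `1`.) -/
def subE (i : Fin t) (a b : ℕ) : PathAlg k t ℓ :=
  (((List.range (b - a)).map fun s => arE i (a + s)).prod)

/-- The `i`-th branch `w i` (the path from the source to the sink along branch `i`)
as an element of the path algebra. -/
def wE (i : Fin t) : PathAlg k t ℓ := subE i 0 (ℓ i)

variable {k : Type u} [Field k]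

/-- A toupie algebra `A = kQ/I`: a toupie quiver `Q` (a non-linear quiver with a unique
source, a unique sink, and all other vertices having exactly one incoming and one
outgoing arrow, i.e. `t ≥ 2` branches of lengths `ℓ i ≥ 1`), together with an admissible
ideal `I` of the path algebra `kQ`.  Since `Q` is finite and acyclic, the arrow ideal is
nilpotent, so admissibility amounts to `I ⊆ R_Q²`, i.e. every element of `I` is a linear
combination of paths of length `≥ 2`. -/
structure ToupieAlg (k : Type u) [Field k] : Type u where
  t : ℕ
  ht : 2 ≤ t
  ℓ : Fin t → ℕ
  hℓ : ∀ i, 1 ≤ ℓ i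
  I : TwoSidedIdeal (PathAlg k t ℓ)
  adm : ∀ x ∈ I, x ∈ Submodule.span k
    {y : PathAlg k t ℓ | ∃ i a b, a + 2 ≤ b ∧ b ≤ ℓ i ∧ y = subE i a b}

variable (T : ToupieAlg k)

/-- The underlying algebra `A = kQ/I` of a toupie algebra. -/
def Alg : Type u := T.I.ringCon.Quotient

instance : Ring (Alg T) := inferInstanceAs (Ring T.I.ringCon.Quotient)

/-- The quotient map `kQ → A = kQ/I`. -/
def mkA : PathAlg k T.t T.ℓ →+* Alg T := T.I.ringCon.mk'

lemma mkA_surjective : Function.Surjective (mkA T) := Quotient.mk''_surjective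

instance : Algebra k (Alg T) :=
  RingHom.toAlgebra' ((mkA T).comp (algebraMap k (PathAlg k T.t T.ℓ)))
    (by
      intro c x
      obtain ⟨y, rfl⟩ := mkA_surjective T x
      simp only [RingHom.coe_comp, Function.comp_apply, ← map_mul]
      rw [Algebra.commutes])

/-- The idempotent `e₀` (at the source) in `A`. -/
def e0 : Alg T := mkA T (eV Vtx.src)

/-- The idempotent `e∞` (at the sink) in `A`. -/
def einf : Alg T := mkA T (eV Vtx.snk)

/-- The `k`-linear map `A → A`, `x ↦ e₀ * x * e∞`, whose range is `e₀ A e∞`. -/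
def lrMap : Alg T →ₗ[k] Alg T where
  toFun x := e0 T * x * einf T
  map_add' x y := by simp [mul_add, add_mul]
  map_smul' c x := by
    simp only [RingHom.id_apply]
    rw [mul_smul_comm, smul_mul_assoc]

/-- `m = dim_k e₀ A e∞`, the dimension of the span of the (residues of the) paths from
the source to the sink. -/
def mDim : ℕ := Module.finrank k ↥(LinearMap.range (lrMap T))

/-- The branch `w i` lies in the ideal `I`. -/
def branchInI (i : Fin T.t) : Prop := wE i ∈ T.I

/-- A minimal relation: `∑_{i ∈ J} λ i • w i ∈ I` with `|J| ≥ 2`, all `λ i ≠ 0`, and no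
nonempty proper subsum in `I`. -/
def MinRel (J : Finset (Fin T.t)) (lam : Fin T.t → k) : Prop :=
  2 ≤ J.card ∧ (∀ i ∈ J, lam i ≠ 0) ∧ (∑ i ∈ J, lam i • wE i) ∈ T.I ∧
    ∀ J' ⊂ J, J'.Nonempty → (∑ i ∈ J', lam i • wE i) ∉ T.I

/-- A toupie algebra is simply connected if any two distinct branches are involved in a
common minimal relation. -/
def SimplyConnected : Prop :=
  ∀ i j : Fin T.t, i ≠ j → ∃ J lam, MinRel T J lam ∧ i ∈ J ∧ j ∈ J

/-- A (minimal) zero-relation on branch `i`: the subpath of branch `i` from its `a`-th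
to its `b`-th vertex lies in `I`, but no proper subpath of it does. -/
def ZeroRel (i : Fin T.t) (a b : ℕ) : Prop :=
  a < b ∧ b ≤ T.ℓ i ∧ subE i a b ∈ T.I ∧
    ∀ a' b', a ≤ a' → b' ≤ b → a' < b' → (a', b') ≠ (a, b) → subE i a' b' ∉ T.I

/-- There is exactly one relation on branch `i`. -/
def ExactlyOneRel (i : Fin T.t) : Prop := ∃! p : ℕ × ℕ, ZeroRel T i p.1 p.2

/-- Branch `i` carries more than one relation. -/
def MoreThanOneRel (i : Fin T.t) : Prop :=
  ∃ p q : ℕ × ℕ, p ≠ q ∧ ZeroRel T i p.1 p.2 ∧ ZeroRel T i q.1 q.2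

/-- At most one branch of `Q` has length at least three. -/
def AtMostOneLongBranch : Prop := ∀ i j : Fin T.t, 3 ≤ T.ℓ i → 3 ≤ T.ℓ j → i = j

/-- The two-sided ideal `I` is generated by the set `S`. -/
def IsGenBy {R : Type u} [Ring R] (I : TwoSidedIdeal R) (S : Set R) : Prop :=
  S ⊆ (I : Set R) ∧ ∀ J : TwoSidedIdeal R, S ⊆ (J : Set R) → (I : Set R) ⊆ (J : Set R)

/-- A toupie algebra is canonical if (after choosing two distinguished branches `i₁, i₂`)
its ideal is generated by `{w i₁ + λ j • w i₂ - w j}` over the remaining branches `j`,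
with the `λ j` pairwise distinct and nonzero. -/
def IsCanonical : Prop :=
  ∃ (i₁ i₂ : Fin T.t) (lam : Fin T.t → k), i₁ ≠ i₂ ∧
    (∀ j, j ≠ i₁ → j ≠ i₂ → lam j ≠ 0) ∧
    (∀ j j', j ≠ i₁ → j ≠ i₂ → j' ≠ i₁ → j' ≠ i₂ → j ≠ j' → lam j ≠ lam j') ∧
    IsGenBy T.I {x | ∃ j, j ≠ i₁ ∧ j ≠ i₂ ∧ x = wE i₁ + lam j • wE i₂ - wE j}

end Toupie
namespace Toupie

/-! ### Module-theoretic notions over an arbitrary ring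

Following the paper, all modules are finite-dimensional *right* modules; a right
`A`-module is formalized as a (left) module over `Aᵐᵒᵖ`.  The definitions below are
stated for modules over an arbitrary ring `R` and are applied with `R := Aᵐᵒᵖ`. -/

variable (R : Type u) [Ring R]

/-- A module is indecomposable if it is nonzero and its only idempotent endomorphisms
are `0` and the identity. -/
def Indec (M : ModuleCat.{u} R) : Prop :=
  Nontrivial M ∧ ∀ f : M →ₗ[R] M, f.comp f = f → f = 0 ∨ f = LinearMap.id

/-- Finiteness ("finite dimensionality") of a module. -/
def FdMod (M : ModuleCat.{u} R) : Prop := Module.Finite R M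

/-- `M` has projective dimension at most one: it is the quotient of a projective module
by a projective submodule. -/
def PdLeOne (M : ModuleCat.{u} R) : Prop :=
  ∃ (P : ModuleCat.{u} R) (f : P →ₗ[R] M), Function.Surjective f ∧
    Module.Projective R P ∧ Module.Projective R ↥(LinearMap.ker f)

/-- `M` has injective dimension at most one: it embeds in an injective module with
injective cokernel. -/
def IdLeOne (M : ModuleCat.{u} R) : Prop :=
  ∃ (E : ModuleCat.{u} R) (f : M →ₗ[R] E), Function.Injective f ∧
    Module.Injective R E ∧ Module.Injective R (E ⧸ LinearMap.range f)

/-- One step of a path in `ind R`: a nonzero non-isomorphism between (finite-dimensional)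
indecomposable modules. -/
def Step (M N : ModuleCat.{u} R) : Prop :=
  Indec R M ∧ FdMod R M ∧ Indec R N ∧ FdMod R N ∧
    ∃ f : M →ₗ[R] N, f ≠ 0 ∧ ¬ Function.Bijective f

/-- A path in `ind R` from `M` to `N` (possibly trivial): a chain
`M = M₀ → M₁ → ⋯ → Mₙ = N` of nonzero non-isomorphisms between indecomposables. -/
def IndPath (M N : ModuleCat.{u} R) : Prop := Relation.ReflTransGen (Step R) M N

/-- The left part `L_R`: the indecomposable (finite-dimensional) modules `M` such that
every indecomposable `X` with a path `X ⇝ M` in `ind R` has projective dimension `≤ 1`. -/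
def InLeftPart (M : ModuleCat.{u} R) : Prop :=
  Indec R M ∧ FdMod R M ∧
    ∀ X : ModuleCat.{u} R, Indec R X → FdMod R X → IndPath R X M → PdLeOne R X

/-- The right part `R_R`: the indecomposable (finite-dimensional) modules `M` such that
every indecomposable `X` with a path `M ⇝ X` in `ind R` has injective dimension `≤ 1`. -/
def InRightPart (M : ModuleCat.{u} R) : Prop :=
  Indec R M ∧ FdMod R M ∧
    ∀ X : ModuleCat.{u} R, Indec R X → FdMod R X → IndPath R M X → IdLeOne R X

/-- Hereditary: global dimension at most one, i.e. every module has projective dimension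
at most one. -/
def Hereditary : Prop := ∀ M : ModuleCat.{u} R, PdLeOne R M

/-- Quasitilted: every indecomposable projective module lies in the left part. -/
def Quasitilted : Prop :=
  ∀ P : ModuleCat.{u} R, Indec R P → FdMod R P → Module.Projective R P → InLeftPart R P

/-- A module is directed if it lies on no cycle of nonzero non-isomorphisms between
indecomposables in `ind R`. -/
def Directed (M : ModuleCat.{u} R) : Prop := ¬ Relation.TransGen (Step R) M M

/-- Weakly shod: every indecomposable (finite-dimensional) module not lying in
`L_R ∪ R_R` is directed. -/
def WeaklyShod : Prop :=
  ∀ M : ModuleCat.{u} R, Indec R M → FdMod R M →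
    ¬ InLeftPart R M → ¬ InRightPart R M → Directed R M

/-- Laura: all but finitely many isomorphism classes of indecomposable
(finite-dimensional) modules lie in `L_R ∪ R_R`. -/
def Laura : Prop :=
  ∃ S : Set (ModuleCat.{u} R), S.Finite ∧
    ∀ M : ModuleCat.{u} R, Indec R M → FdMod R M →
      ¬ InLeftPart R M → ¬ InRightPart R M → ∃ N ∈ S, Nonempty (M ≃ₗ[R] N)

/-- There are exactly `n` isomorphism classes of modules satisfying `P`. -/
def NumClasses (P : ModuleCat.{u} R → Prop) (n : ℕ) : Prop :=
  ∃ f : Fin n → ModuleCat.{u} R, (∀ i, P (f i)) ∧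
    (∀ i j, Nonempty ((f i : Type u) ≃ₗ[R] (f j : Type u)) → i = j) ∧
    ∀ M : ModuleCat.{u} R, P M → ∃ i, Nonempty ((M : Type u) ≃ₗ[R] (f i : Type u))

/-- `M` is (isomorphic to) a direct summand of `T`. -/
def IsSummandOf (T : Type u) [AddCommGroup T] [Module R T] (M : ModuleCat.{u} R) : Prop :=
  ∃ N N' : Submodule R T, IsCompl N N' ∧ Nonempty ((M : Type u) ≃ₗ[R] N)

/-- `Ext¹_R(T, T) = 0`: every self-extension `0 → T → E → T → 0` splits. -/
def SelfExtVanish (T : Type u) [AddCommGroup T] [Module R T] : Prop :=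
  ∀ (E : Type u) [AddCommGroup E] [Module R E] (ι : T →ₗ[R] E) (π : E →ₗ[R] T),
    Function.Injective ι → Function.Surjective π → LinearMap.range ι = LinearMap.ker π →
      ∃ s : T →ₗ[R] E, π.comp s = LinearMap.id

/-- A tilting module over a hereditary algebra: a finite module with `Ext¹(T,T) = 0`
having as many pairwise non-isomorphic indecomposable direct summands as there are
simple modules. -/
def IsTiltingMod (T : Type u) [AddCommGroup T] [Module R T] : Prop :=
  Module.Finite R T ∧ SelfExtVanish R T ∧
    ∃ n : ℕ, NumClasses R (fun M => Indec R M ∧ IsSummandOf R T M) n ∧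
      NumClasses R (fun M => IsSimpleModule R M) n

variable (k : Type u) [Field k]

/-- A `k`-algebra `A` is tilted if it is the endomorphism algebra of a tilting (right)
module over a hereditary finite-dimensional `k`-algebra `H`.  (Right `H`-modules are
modules over `Hᵐᵒᵖ`; the isomorphism `A ≅ End_H T` is a `k`-linear ring isomorphism.) -/
def IsTilted (A : Type u) [Ring A] [Algebra k A] : Prop :=
  ∃ (H : Type u) (_ : Ring H) (_ : Algebra k H),
    FiniteDimensional k H ∧ Hereditary Hᵐᵒᵖ ∧
      ∃ (T : Type u) (_ : AddCommGroup T) (_ : Module Hᵐᵒᵖ T),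
        IsTiltingMod Hᵐᵒᵖ T ∧
          ∃ (_ : Module k T) (_ : SMulCommClass Hᵐᵒᵖ k T) (_ : IsScalarTower k Hᵐᵒᵖ T)
            (φ : A ≃+* Module.End Hᵐᵒᵖ T), ∀ (c : k) (x : A), φ (c • x) = c • φ x

end Toupie
namespace Toupie

variable {k : Type u} [Field k] (T : ToupieAlg k)

/-! ### Right `A`-modules as representations of `(Q, I)`

For a right `A`-module `M` (a module over `Aᵐᵒᵖ`) and a vertex `v`, the space of the
corresponding representation at `v` is `M_v = M • e_v`. -/

/-- The action of the idempotent `e_v ∈ A` on a right `A`-module (= `Aᵐᵒᵖ`-module). -/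
def actV (v : Vtx T.t T.ℓ) : (Alg T)ᵐᵒᵖ := op (mkA T (eV v))

/-- The space `M_v = M • e_v` of the representation `M` at the vertex `v` is zero. -/
def VanishAt (M : ModuleCat.{u} (Alg T)ᵐᵒᵖ) (v : Vtx T.t T.ℓ) : Prop :=
  ∀ m : M, actV T v • m = 0

/-- Every simple summand of `top M = M / rad M` is one of the simple modules `S_v`,
`v ∈ vs`: for every maximal submodule `N` the simple quotient `M/N` is supported at some
vertex of `vs` (for an admissible quotient of a path algebra, the simple module `S_v` is
the unique simple on which `e_v` acts nontrivially). -/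
def TopIn (M : ModuleCat.{u} (Alg T)ᵐᵒᵖ) (vs : Set (Vtx T.t T.ℓ)) : Prop :=
  ∀ N : Submodule (Alg T)ᵐᵒᵖ M, IsCoatom N → ∃ v ∈ vs, ∃ m : M, actV T v • m ∉ N

/-- Every simple summand of the socle of `M` is one of the simple modules `S_v`,
`v ∈ vs`: every simple submodule `N ≤ M` is supported at some vertex of `vs`. -/
def SocIn (M : ModuleCat.{u} (Alg T)ᵐᵒᵖ) (vs : Set (Vtx T.t T.ℓ)) : Prop :=
  ∀ N : Submodule (Alg T)ᵐᵒᵖ M, IsAtom N → ∃ v ∈ vs, ∃ m ∈ N, actV T v • m ≠ 0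

/-- The module `D x y` (for two positions `0 ≤ x, y ≤ ℓ i₀` on the unique branch `i₀`
lying in `I`, and an auxiliary branch `i₂ ≠ i₀`): the right `A`-module with generators
`g = e₀` (at the source) and `h = e_y` (at the `y`-th vertex of branch `i₀`), subject to
the relations `g ⬝ (subpath of w i₀ from 0 to x+1) = 0` and
`g ⬝ w i₂ = h ⬝ (subpath of w i₀ from y to ℓ i₀)`.  It is presented as the quotient of
the right regular module `A ⊕ A` by the right submodule generated by
`(1 - e₀, 0)`, `(0, 1 - e_y)`, `(subE i₀ 0 (min (x+1) (ℓ i₀)), 0)` and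
`(w i₂, - subE i₀ y (ℓ i₀))`. -/
abbrev Dmod (i₀ i₂ : Fin T.t) (x y : ℕ) : Type u :=
  (Alg T × Alg T) ⧸ Submodule.span (Alg T)ᵐᵒᵖ
    ({((mkA T (1 - eV Vtx.src) : Alg T), (0 : Alg T)),
      ((0 : Alg T), (mkA T (1 - eV (vtx T.t T.ℓ i₀ y)) : Alg T)),
      ((mkA T (subE i₀ 0 (min (x + 1) (T.ℓ i₀))) : Alg T), (0 : Alg T)),
      ((mkA T (wE i₂) : Alg T), (- mkA T (subE i₀ y (T.ℓ i₀)) : Alg T))} :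
        Set (Alg T × Alg T))

end Toupie

namespace Toupie

section Abstract

/-- Left modules of `k`-linear functionals on `B`, with action `(b • φ) x = φ (x * b)`. -/
def DualMod (k B : Type u) [Field k] [Ring B] [Algebra k B] : Type u := B →ₗ[k] k

variable {k B : Type u} [Field k] [Ring B] [Algebra k B]

instance : AddCommGroup (DualMod k B) := inferInstanceAs (AddCommGroup (B →ₗ[k] k))

instance : Module k (DualMod k B) := inferInstanceAs (Module k (B →ₗ[k] k))

instance : FunLike (DualMod k B) B k := inferInstanceAs (FunLike (B →ₗ[k] k) B k)

instance : LinearMapClass (DualMod k B) k B k :=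
  inferInstanceAs (LinearMapClass (B →ₗ[k] k) k B k)

instance [FiniteDimensional k B] : FiniteDimensional k (DualMod k B) :=
  inferInstanceAs (FiniteDimensional k (B →ₗ[k] k))

@[ext] lemma DualMod.ext {φ ψ : DualMod k B} (h : ∀ x, φ x = ψ x) : φ = ψ :=
  LinearMap.ext h

@[simp] lemma DualMod.add_apply (φ ψ : DualMod k B) (x : B) : (φ + ψ) x = φ x + ψ x := rfl

@[simp] lemma DualMod.sub_apply (φ ψ : DualMod k B) (x : B) : (φ - ψ) x = φ x - ψ x := rfl

@[simp] lemma DualMod.zero_apply (x : B) : (0 : DualMod k B) x = 0 := rfl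

@[simp] lemma DualMod.ksmul_apply (c : k) (φ : DualMod k B) (x : B) : (c • φ) x = c * φ x := rfl

instance : SMul B (DualMod k B) :=
  ⟨fun b φ => LinearMap.comp (φ : B →ₗ[k] k) (LinearMap.mulRight k b)⟩

@[simp] lemma DualMod.smul_apply (b : B) (φ : DualMod k B) (x : B) : (b • φ) x = φ (x * b) := rfl

instance : Module B (DualMod k B) where
  one_smul φ := by ext x; simp
  mul_smul b c φ := by ext x; simp [mul_assoc]
  smul_zero b := by ext x; simp
  smul_add b φ ψ := by ext x; simp
  add_smul b c φ := by ext x; simp [mul_add]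
  zero_smul φ := by ext x; simp

instance : IsScalarTower k B (DualMod k B) :=
  ⟨fun c b φ => by ext x; simp⟩

instance [FiniteDimensional k B] : Module.Finite B (DualMod k B) :=
  Module.Finite.of_restrictScalars_finite k B _

lemma DualMod.exists_apply_ne_zero {x : B} (hx : x ≠ 0) : ∃ φ : DualMod k B, φ x ≠ 0 := by
  by_contra! h
  exact hx ((Module.forall_dual_apply_eq_zero_iff k x).1 h)

/-- The indecomposable injective module dual to the right ideal generated by `e`. -/
def injMod (k : Type u) [Field k] [Algebra k B] (e : B) : Submodule B (DualMod k B) where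
  carrier := {φ | ∀ x, φ (e * x) = φ x}
  add_mem' h h' x := by simp [h x, h' x]
  zero_mem' x := by simp
  smul_mem' b φ h x := by simp [mul_assoc, h (x * b)]

lemma indec_of_le_injMod {e : B} (hom : ∀ x, ∃ c : k, e * x * e = c • e)
    {N : Submodule B (DualMod k B)} (hN : N ≤ injMod k e) (h0 : N ≠ ⊥) :
    Indec B (ModuleCat.of B N) := by
  refine ⟨(Submodule.nontrivial_iff_ne_bot).2 h0, fun f hf => ?_⟩
  change N →ₗ[B] N at f
  have key : ∀ φ : N, φ ≠ 0 → ∃ x : B, φ.1 x ≠ 0 ∧ ∀ y (c : k), e * y * e = c • e →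
      (x • φ).1 y = c * φ.1 x := by
    intro φ hφ
    have : ∃ x, φ.1 x ≠ 0 := by
      by_contra! h
      exact hφ (Subtype.ext (DualMod.ext h))
    obtain ⟨x, hx⟩ := this
    have he := hN φ.2
    refine ⟨e * x, by rwa [he], fun y c hc => ?_⟩
    have : e * (y * (e * x)) = c • (e * x) := by
      rw [← smul_mul_assoc, ← hc]; simp only [mul_assoc]
    change φ.1 (y * (e * x)) = _
    rw [← he (y * _), this, map_smul, smul_eq_mul]
  have hff : ∀ m, f (f m) = f m := fun m => LinearMap.congr_fun hf m
  by_contra! hcon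
  obtain ⟨h1, h2⟩ := hcon
  obtain ⟨m, hm⟩ : ∃ m, f m ≠ 0 := by
    by_contra! h; exact h1 (LinearMap.ext h)
  obtain ⟨m', hm'⟩ : ∃ m, f m ≠ m := by
    by_contra! h; exact h2 (LinearMap.ext h)
  obtain ⟨x, hx, hx'⟩ := key (f m) hm
  obtain ⟨y, hy, hy'⟩ := key (m' - f m') (sub_ne_zero.2 (Ne.symm hm'))
  set φ := f m with hφ
  set ψ := m' - f m' with hψ
  have hfφ : f φ = φ := hff m
  have hfψ : f ψ = 0 := by rw [hψ, map_sub, hff, sub_self]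
  have heq : (ψ.1 y) • (x • φ) = (φ.1 x) • (y • ψ) := by
    ext z
    obtain ⟨c, hc⟩ := hom z
    change ψ.1 y * (x • φ).1 z = φ.1 x * (y • ψ).1 z
    rw [hx' z c hc, hy' z c hc]; ring
  have hsm : ∀ (c : k) (z : N), c • z = (algebraMap k B c) • z := fun c z => by
    rw [algebraMap_smul]
  have h3 : (ψ.1 y) • (x • φ) = 0 := by
    have := congrArg f heq
    simp only [hsm, map_smul, hfφ, hfψ, smul_zero] at this
    rwa [hsm]
  have h4 : ψ.1 y * φ.1 x = 0 := by
    have := congrArg (fun z : N => z.1 1) h3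
    simpa using this
  exact (mul_ne_zero hy hx) h4

lemma indec_quotient {e : B} (hom : ∀ x, ∃ c : k, e * x * e = c • e)
    {J : Submodule B B} (he : 1 - e ∈ J) (h1 : (1 : B) ∉ J) :
    Indec B (ModuleCat.of B (B ⧸ J)) := by
  have hJ : J ≠ ⊤ := fun h => h1 (h ▸ Submodule.mem_top)
  refine ⟨Submodule.Quotient.nontrivial_iff.2 hJ, fun f hf => ?_⟩
  change B ⧸ J →ₗ[B] B ⧸ J at f
  have hff : ∀ m, f (f m) = f m := fun m => LinearMap.congr_fun hf m
  have hgen : ∀ x : B, J.mkQ x = x • J.mkQ 1 := fun x => by rw [← map_smul, smul_eq_mul, mul_one]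
  have h1e : J.mkQ 1 = J.mkQ e := (Submodule.Quotient.eq J).2 he
  obtain ⟨x, hx⟩ := J.mkQ_surjective (f (J.mkQ 1))
  obtain ⟨c, hc⟩ := hom x
  have hfc : f (J.mkQ 1) = algebraMap k B c • J.mkQ 1 := by
    calc f (J.mkQ 1) = f (e • J.mkQ 1) := by rw [← hgen, ← h1e]
      _ = e • (x • J.mkQ 1) := by rw [map_smul, ← hx, ← hgen]
      _ = e • (x • (e • J.mkQ 1)) := by rw [← hgen e, ← h1e]
      _ = (e * x * e) • J.mkQ 1 := by simp only [mul_smul]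
      _ = algebraMap k B c • (e • J.mkQ 1) := by rw [hc, Algebra.smul_def, mul_smul]
      _ = _ := by rw [← hgen e, ← h1e]
  have hcc : (c * c - c) • J.mkQ 1 = 0 := by
    have := hff (J.mkQ 1)
    rw [hfc, map_smul, hfc, ← mul_smul, ← map_mul, ← sub_eq_zero, ← sub_smul, ← map_sub,
      algebraMap_smul] at this
    exact this
  have hne : J.mkQ 1 ≠ 0 := fun h => h1 ((Submodule.Quotient.mk_eq_zero J).1 h)
  have hc01 : c * (c - 1) = 0 := by
    have := (smul_eq_zero.1 hcc).resolve_right hne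
    linear_combination this
  rcases mul_eq_zero.1 hc01 with h | h
  · left
    refine LinearMap.ext fun z => ?_
    obtain ⟨z, rfl⟩ := J.mkQ_surjective z
    change f (J.mkQ z) = 0
    rw [hgen, map_smul, hfc, h]; simp
  · right
    refine LinearMap.ext fun z => ?_
    obtain ⟨z, rfl⟩ := J.mkQ_surjective z
    change f (J.mkQ z) = J.mkQ z
    rw [hgen, map_smul, hfc, sub_eq_zero.1 h]; simp

lemma projective_quotient {e : B} (he : e * e = e) :
    Module.Projective B (B ⧸ Submodule.span B {1 - e}) := by
  refine Module.Projective.of_split (M := B)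
    (Submodule.liftQ _ (LinearMap.toSpanSingleton B B e) ?_) (Submodule.mkQ _) ?_
  · rw [Submodule.span_le]
    rintro _ rfl
    simp [sub_mul, he]
  · ext
    simp only [LinearMap.comp_apply, Submodule.mkQ_apply, Submodule.liftQ_apply,
      LinearMap.toSpanSingleton_apply, one_smul, LinearMap.id_apply]
    rw [Submodule.Quotient.eq]
    rw [← neg_sub (1 : B) e, Submodule.neg_mem_iff]
    exact Submodule.mem_span_singleton_self _

section ExtTwo

variable {R : Type u} [Ring R]

/-- If `X` has projective dimension at most one then `Ext²(X, -)` vanishes. -/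
lemma PdLeOne.exists_extension {X : ModuleCat.{u} R} (hX : PdLeOne R X)
    {P₁ P₀ Y : Type u} [AddCommGroup P₁] [Module R P₁] [AddCommGroup P₀] [Module R P₀]
    [AddCommGroup Y] [Module R Y] [Module.Projective R P₀]
    (d : P₁ →ₗ[R] P₀) (π : P₀ →ₗ[R] X) (hπ : Function.Surjective π)
    (hex : LinearMap.range d = LinearMap.ker π)
    (φ : LinearMap.ker d →ₗ[R] Y) :
    ∃ ψ : P₁ →ₗ[R] Y, ∀ x : LinearMap.ker d, ψ x = φ x := by
  obtain ⟨P, f, hf, hP, hK⟩ := hX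
  obtain ⟨u, hu⟩ := Module.projective_lifting_property f π hf
  have hdπ : ∀ x, π (d x) = 0 := fun x => by
    have : d x ∈ LinearMap.ker π := hex ▸ LinearMap.mem_range_self d x
    exact this
  · obtain ⟨v, hv⟩ := Module.projective_lifting_property π f hπ
    have hu' : ∀ x, f (u x) = π x := fun x => LinearMap.congr_fun hu x
    have hv' : ∀ x, π (v x) = f x := fun x => LinearMap.congr_fun hv x
    let d' : P₁ →ₗ[R] LinearMap.ker π := d.codRestrict _ fun x => hdπ x
    have hd' : Function.Surjective d' := by
      rintro ⟨y, hy⟩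
      rw [← hex] at hy
      obtain ⟨x, rfl⟩ := hy
      exact ⟨x, rfl⟩
    let v' : LinearMap.ker f →ₗ[R] LinearMap.ker π :=
      (v.domRestrict (LinearMap.ker f)).codRestrict _ fun x => by
        have := x.2
        rw [LinearMap.mem_ker] at this ⊢
        rw [LinearMap.domRestrict_apply, hv', this]
    let z' : P₀ →ₗ[R] LinearMap.ker π :=
      (LinearMap.id - v.comp u).codRestrict _ fun x => by
        simp [LinearMap.mem_ker, hv', hu']
    obtain ⟨w, hw⟩ := Module.projective_lifting_property d' v' hd'
    obtain ⟨z, hz⟩ := Module.projective_lifting_property d' z' hd'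
    have hw' : ∀ x, d (w x) = v x := fun x =>
      congrArg Subtype.val (LinearMap.congr_fun hw x)
    have hz' : ∀ x, d (z x) = x - v (u x) := fun x =>
      congrArg Subtype.val (LinearMap.congr_fun hz x)
    let ud : P₁ →ₗ[R] LinearMap.ker f := (u.comp d).codRestrict _ fun x => by
      simp [LinearMap.mem_ker, hu', hdπ]
    let s : P₁ →ₗ[R] P₁ := w.comp ud + z.comp d
    have hs : ∀ x, d (s x) = d x := fun x => by
      simp [s, hw', hz', ud]
    refine ⟨φ.comp ((LinearMap.id - s).codRestrict _ fun x => by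
      simp [LinearMap.mem_ker, hs]), fun x => ?_⟩
    have hx : d x = 0 := x.2
    have : s x = 0 := by
      have h0 : ud x = 0 := Subtype.ext (by simp [ud, hx])
      simp [s, hx, h0]
    rw [LinearMap.comp_apply]
    congr 1
    exact Subtype.ext (by simp [this])

/-- If `Y` has injective dimension at most one then `Ext²(-, Y)` vanishes. -/
lemma IdLeOne.exists_extension {Y : ModuleCat.{u} R} (hY : IdLeOne R Y)
    {P₁ P₀ : Type u} [AddCommGroup P₁] [Module R P₁] [AddCommGroup P₀] [Module R P₀]
    [Module.Projective R P₀] (d : P₁ →ₗ[R] P₀) (φ : LinearMap.ker d →ₗ[R] Y) :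
    ∃ ψ : P₁ →ₗ[R] Y, ∀ x : LinearMap.ker d, ψ x = φ x := by
  obtain ⟨E, i, hi, hE, hC⟩ := hY
  obtain ⟨α, hα⟩ := hE.out (LinearMap.ker d).subtype (Submodule.subtype_injective _) (i.comp φ)
  let p := (LinearMap.range i).mkQ
  have hp : ∀ e, p e = 0 ↔ e ∈ LinearMap.range i := fun e => Submodule.Quotient.mk_eq_zero _
  let α' : (P₁ ⧸ LinearMap.ker d) →ₗ[R] (E ⧸ LinearMap.range i) :=
    Submodule.liftQ _ (p.comp α) fun x hx => by
      have := hα ⟨x, hx⟩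
      simp only [LinearMap.mem_ker, LinearMap.comp_apply, hp]
      exact ⟨φ ⟨x, hx⟩, this.symm⟩
  let d' : (P₁ ⧸ LinearMap.ker d) →ₗ[R] P₀ := Submodule.liftQ _ d le_rfl
  have hd' : Function.Injective d' :=
    LinearMap.ker_eq_bot.1 (Submodule.ker_liftQ_eq_bot _ _ _ le_rfl)
  obtain ⟨β, hβ⟩ := hC.out d' hd' α'
  obtain ⟨γ, hγ⟩ := Module.projective_lifting_property p β (Submodule.mkQ_surjective _)
  have hmem : ∀ x, (α - γ.comp d) x ∈ LinearMap.range i := fun x => by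
    rw [← hp, LinearMap.sub_apply, map_sub, sub_eq_zero]
    have h1 := hβ ((LinearMap.ker d).mkQ x)
    have h2 := LinearMap.congr_fun hγ (d x)
    simp only [d', α', Submodule.mkQ_apply, Submodule.liftQ_apply, LinearMap.comp_apply] at h1 h2
    rw [← h1, ← h2]
    rfl
  let j := LinearEquiv.ofInjective i hi
  refine ⟨j.symm.toLinearMap.comp ((α - γ.comp d).codRestrict _ hmem), fun x => ?_⟩
  apply hi
  have h3 : ∀ z, i (j.symm z) = z := fun z => congrArg Subtype.val (j.apply_symm_apply z)
  have hx : d x = 0 := x.2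
  have h4 : α x = i (φ x) := hα x
  simp [h3, hx, h4]

end ExtTwo
/-- A chain `0 → 1 → ⋯ → n` in the quiver of `B`, with `q u v` the residue class of the path
from `u` to `v`, whose interior vertices carry no other arrow.  The whole path is zero in `B`,
but the Peirce component from `0` to `n` is not. -/
structure ZeroChain (k B : Type u) [Field k] [Ring B] [Algebra k B] where
  n : ℕ
  q : ℕ → ℕ → B
  mul : ∀ {u v w}, u ≤ v → v ≤ w → w ≤ n → q v w * q u v = q u w
  arrow : ∀ {u}, u < n → q u (u + 1) ≠ 0
  hom : ∀ {u v}, u ≤ v → v ≤ n → (0 < u ∨ v < n) → ∀ x, ∃ c : k, q v v * x * q u u = c • q u v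
  hom_zero : ∀ {u v}, u < v → v ≤ n → ∀ x, q u u * x * q v v = 0
  row : ∀ {v}, 0 < v → v < n → ∀ x, q v v * x = ∑ u ∈ Finset.range (n + 1), q v v * x * q u u
  col : ∀ {u}, 0 < u → u < n → ∀ x, x * q u u = ∑ v ∈ Finset.range (n + 1), q v v * x * q u u
  zero : q 0 n = 0
  nonzero : ∃ x, q n n * x * q 0 0 ≠ 0

namespace ZeroChain

variable (C : ZeroChain k B)

lemma right_id {u v : ℕ} (h : u ≤ v) (hv : v ≤ C.n) : C.q u v * C.q u u = C.q u v :=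
  C.mul le_rfl h hv

lemma left_id {u v : ℕ} (h : u ≤ v) (hv : v ≤ C.n) : C.q v v * C.q u v = C.q u v :=
  C.mul h le_rfl hv

lemma idem {u : ℕ} (hu : u ≤ C.n) : C.q u u * C.q u u = C.q u u := C.mul le_rfl le_rfl hu

lemma source_ne_zero : C.q 0 0 ≠ 0 := by
  obtain ⟨x, hx⟩ := C.nonzero
  exact fun h => hx (by rw [h, mul_zero])

lemma sink_ne_zero : C.q C.n C.n ≠ 0 := by
  obtain ⟨x, hx⟩ := C.nonzero
  exact fun h => hx (by rw [h, zero_mul, zero_mul])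

lemma pos : 0 < C.n := by
  rcases Nat.eq_zero_or_pos C.n with h | h
  · have := C.zero
    rw [h] at this
    exact absurd this C.source_ne_zero
  · exact h

lemma vertex_ne_zero {u : ℕ} (hu : u ≤ C.n) : C.q u u ≠ 0 := by
  rcases hu.lt_or_eq with h | rfl
  · intro h0
    apply C.arrow h
    rw [← C.right_id (Nat.le_succ u) h, h0, mul_zero]
  · exact C.sink_ne_zero

lemma hom_vertex {u : ℕ} (hu : u ≤ C.n) (x : B) : ∃ c : k, C.q u u * x * C.q u u = c • C.q u u :=
  C.hom le_rfl hu (by have := C.pos; omega) x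

/-- The start of the last zero relation on the chain and its end. -/
lemma exists_last_relation : ∃ a b, a + 2 ≤ b ∧ b ≤ C.n ∧ C.q a C.n = 0 ∧ C.q a b = 0 ∧
    C.q (a + 1) C.n ≠ 0 ∧ C.q a (b - 1) ≠ 0 := by
  have hex : ∃ d, C.q (C.n - d) C.n = 0 := ⟨C.n, by rw [Nat.sub_self]; exact C.zero⟩
  have hd := Nat.find_spec hex
  have hd' := fun m => Nat.find_min (m := m) hex
  set d := Nat.find hex
  have hd0 : d ≠ 0 := fun h => C.sink_ne_zero (by simpa [h] using hd)
  have hdn : d ≤ C.n := by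
    by_contra! h
    exact hd' C.n h (by rw [Nat.sub_self]; exact C.zero)
  obtain ⟨a, ha⟩ : ∃ a, a = C.n - d := ⟨_, rfl⟩
  rw [← ha] at hd
  have ha1 : C.q (a + 1) C.n ≠ 0 := by
    have := hd' (d - 1) (by omega)
    rwa [show C.n - (d - 1) = a + 1 by omega] at this
  have hex' : ∃ b, a ≤ b ∧ C.q a b = 0 := ⟨C.n, by omega, hd⟩
  obtain ⟨hab, hb⟩ := Nat.find_spec hex'
  have hb' := fun m => Nat.find_min (m := m) hex'
  have hbn : Nat.find hex' ≤ C.n := Nat.find_min' hex' ⟨by omega, hd⟩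
  set b := Nat.find hex'
  have hne : b ≠ a := fun h => C.vertex_ne_zero (u := a) (by omega) (h ▸ hb)
  have hne1 : b ≠ a + 1 := fun h => C.arrow (u := a) (by omega) (h ▸ hb)
  refine ⟨a, b, by omega, hbn, hd, hb, ha1, fun h => ?_⟩
  exact hb' (b - 1) (by omega) ⟨by omega, h⟩

/-- The left ideal presenting a quotient of the projective module at the vertex `j`. -/
def ideal (d : B) (a j : ℕ) : Submodule B B :=
  Submodule.span B {1 - C.q j j, d * C.q j (a + 1)}

lemma one_sub_mem_ideal (d : B) (a j : ℕ) : 1 - C.q j j ∈ C.ideal d a j :=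
  Submodule.subset_span (Or.inl rfl)

lemma mul_vertex_of_mem_ideal {d : B} {a j : ℕ} (hj : j ≤ a) (ha : a < C.n) {x : B}
    (hx : x ∈ C.ideal d a j) : ∃ z, x * C.q j j = z * C.q j (a + 1) := by
  obtain ⟨y, z, rfl⟩ := Submodule.mem_span_pair.1 hx
  refine ⟨z * d, ?_⟩
  have := C.idem (u := j) (by omega)
  have := C.right_id (u := j) (v := a + 1) (by omega) (by omega)
  simp only [smul_eq_mul, add_mul, mul_assoc, sub_mul, one_mul, mul_sub, *]
  simp

lemma vertex_mul_path {j m : ℕ} (h : j < m) (hm : m ≤ C.n) (z : B) :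
    C.q j j * (z * C.q j m) = 0 := by
  rw [← C.left_id h.le hm, ← mul_assoc z, ← mul_assoc, ← mul_assoc, C.hom_zero h hm, zero_mul]

lemma one_notMem_sup {d : B} {a j : ℕ} (hj : j ≤ a) (ha : a < C.n) (x : B) {m : ℕ} (hm : j < m)
    (hmn : m ≤ C.n) : x * C.q j m - 1 ∉ C.ideal d a j := by
  intro h
  obtain ⟨z, hz⟩ := C.mul_vertex_of_mem_ideal hj ha h
  have := congrArg (C.q j j * ·) hz
  simp only [sub_mul, one_mul, mul_sub, mul_assoc] at this
  rw [C.vertex_mul_path (by omega) (by omega), C.right_id hm.le hmn, C.vertex_mul_path hm hmn,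
    C.idem (by omega), zero_sub, neg_eq_zero] at this
  exact C.vertex_ne_zero (by omega) this

lemma one_notMem_ideal {d : B} {a j : ℕ} (hj : j ≤ a) (ha : a < C.n) :
    (1 : B) ∉ C.ideal d a j := by
  have := C.one_notMem_sup (d := d) hj ha 0 (m := a + 1) (by omega) (by omega)
  rwa [zero_mul, zero_sub, Submodule.neg_mem_iff] at this

lemma indec_quotient_ideal {d : B} {a j : ℕ} (hj : j ≤ a) (ha : a < C.n) :
    Indec B (ModuleCat.of B (B ⧸ C.ideal d a j)) :=
  indec_quotient (C.hom_vertex (by omega)) (C.one_sub_mem_ideal d a j) (C.one_notMem_ideal hj ha)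

lemma fdMod_quotient_ideal (d : B) (a j : ℕ) :
    FdMod B (ModuleCat.of B (B ⧸ C.ideal d a j)) :=
  inferInstanceAs (Module.Finite B (B ⧸ C.ideal d a j))

/-- The map out of the quotient of the projective module at `j` given by an element `m`. -/
def liftIdeal {M : Type u} [AddCommGroup M] [Module B M] (d : B) (a j : ℕ) (m : M)
    (h1 : C.q j j • m = m) (h2 : (d * C.q j (a + 1)) • m = 0) : (B ⧸ C.ideal d a j) →ₗ[B] M :=
  Submodule.liftQ _ (LinearMap.toSpanSingleton B M m) <| by
    rw [ideal, Submodule.span_le]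
    rintro _ (rfl | rfl)
    · simp [sub_smul, h1]
    · simpa using h2

lemma liftIdeal_mkQ {M : Type u} [AddCommGroup M] [Module B M] {d : B} {a j : ℕ} {m : M}
    (h1 : C.q j j • m = m) (h2 : (d * C.q j (a + 1)) • m = 0) (x : B) :
    C.liftIdeal d a j m h1 h2 ((C.ideal d a j).mkQ x) = x • m := rfl

lemma step_quotient {d : B} {a j : ℕ} (hj : j < a) (ha : a < C.n) :
    Step B (ModuleCat.of B (B ⧸ C.ideal d a (j + 1))) (ModuleCat.of B (B ⧸ C.ideal d a j)) := by
  refine ⟨C.indec_quotient_ideal hj ha, C.fdMod_quotient_ideal _ _ _,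
    C.indec_quotient_ideal hj.le ha, C.fdMod_quotient_ideal _ _ _,
    C.liftIdeal d a (j + 1) ((C.ideal d a j).mkQ (C.q j (j + 1))) ?_ ?_, ?_, ?_⟩
  · rw [← map_smul, smul_eq_mul, C.left_id (by omega) (by omega)]
  · rw [← map_smul, smul_eq_mul, mul_assoc, C.mul (by omega) (by omega) (by omega)]
    exact (Submodule.Quotient.mk_eq_zero _).2 (Submodule.subset_span (Or.inr rfl))
  · intro h
    have h1 := LinearMap.congr_fun h ((C.ideal d a (j + 1)).mkQ 1)
    rw [liftIdeal_mkQ, one_smul] at h1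
    obtain ⟨z, hz⟩ := C.mul_vertex_of_mem_ideal hj.le ha
      ((Submodule.Quotient.mk_eq_zero _).1 h1)
    apply C.arrow (u := j) (by omega)
    rw [C.right_id (by omega) (by omega)] at hz
    rw [← C.left_id (by omega) (by omega), hz,
      ← C.left_id (u := j) (v := a + 1) (by omega) (by omega), ← mul_assoc z, ← mul_assoc,
      ← mul_assoc, C.hom_zero (by omega) (by omega), zero_mul]
  · rintro ⟨-, h⟩
    obtain ⟨y, hy⟩ := h ((C.ideal d a j).mkQ 1)
    obtain ⟨y, rfl⟩ := Submodule.mkQ_surjective _ y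
    change C.liftIdeal _ _ _ _ _ _ _ = _ at hy
    rw [liftIdeal_mkQ, ← map_smul] at hy
    exact C.one_notMem_sup hj.le ha y (by omega) (by omega) ((Submodule.Quotient.eq _).1 hy)

lemma indPath_quotient {d : B} {a j : ℕ} (hj : j ≤ a) (ha : a < C.n) :
    IndPath B (ModuleCat.of B (B ⧸ C.ideal d a j)) (ModuleCat.of B (B ⧸ C.ideal d a 0)) := by
  induction j with
  | zero => exact Relation.ReflTransGen.refl
  | succ j ih => exact (ih (by omega)).head (C.step_quotient hj ha)

lemma apply_path_eq_zero {a u : ℕ} (h : C.q a C.n = 0) (hu : u ≤ a) (ha : a ≤ C.n) :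
    C.q u C.n = 0 := by
  rw [← C.mul hu ha le_rfl, h, zero_mul]

/-- Functionals on `B` mapped to the projective module at the vertex `a`. -/
def dualToProj {a : ℕ} (h : C.q a C.n = 0) (ha : a ≤ C.n) : DualMod k B →ₗ[B] B where
  toFun φ := ∑ v ∈ Finset.Ioo a C.n, φ (C.q v C.n) • C.q a v
  map_add' φ ψ := by simp [add_smul, Finset.sum_add_distrib]
  map_smul' x φ := by
    have hsub : Finset.Ioo a C.n ⊆ Finset.range (C.n + 1) := fun u hu => by
      simp only [Finset.mem_Ioo, Finset.mem_range] at hu ⊢; omega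
    have key : ∀ u ∈ Finset.Ioo a C.n, ∀ v ∈ Finset.Ioo a C.n,
        φ (C.q v C.n * (C.q v v * x * C.q u u)) • C.q a v =
          φ (C.q u C.n) • (C.q v v * x * C.q u u * C.q a u) := by
      intro u hu v hv
      simp only [Finset.mem_Ioo] at hu hv
      by_cases huv : u ≤ v
      · obtain ⟨c, hc⟩ := C.hom huv (by omega) (by omega) x
        rw [hc, mul_smul_comm, C.mul huv (by omega) le_rfl, smul_mul_assoc,
          C.mul (by omega) huv (by omega), map_smul, smul_smul, smul_eq_mul, mul_comm]
      · rw [C.hom_zero (by omega) (by omega)]; simp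
    have hL : ∀ v ∈ Finset.Ioo a C.n, (x • φ) (C.q v C.n) • C.q a v =
        ∑ u ∈ Finset.Ioo a C.n, φ (C.q v C.n * (C.q v v * x * C.q u u)) • C.q a v := by
      intro v hv
      simp only [Finset.mem_Ioo] at hv
      rw [← Finset.sum_smul, ← map_sum, ← Finset.mul_sum, DualMod.smul_apply]
      congr 2
      rw [Finset.mul_sum]
      conv_lhs => rw [← C.right_id (u := v) (by omega) le_rfl, mul_assoc, C.row (by omega) hv.2,
        Finset.mul_sum]
      symm
      apply Finset.sum_subset hsub
      intro u hu hu'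
      simp only [Finset.mem_Ioo, Finset.mem_range] at hu hu'
      by_cases huv : u ≤ v
      · obtain ⟨c, hc⟩ := C.hom huv (by omega) (by omega) x
        rw [hc, mul_smul_comm, C.mul huv (by omega) le_rfl,
          C.apply_path_eq_zero h (by omega) ha, smul_zero]
      · rw [C.hom_zero (by omega) (by omega), mul_zero]
    have hR : ∀ u ∈ Finset.Ioo a C.n, x * (φ (C.q u C.n) • C.q a u) =
        ∑ v ∈ Finset.Ioo a C.n, φ (C.q u C.n) • (C.q v v * x * C.q u u * C.q a u) := by
      intro u hu
      simp only [Finset.mem_Ioo] at hu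
      rw [← Finset.smul_sum, mul_smul_comm, ← Finset.sum_mul]
      congr 1
      conv_lhs => rw [← C.left_id (u := a) (v := u) (by omega) (by omega), ← mul_assoc,
        C.col (by omega) hu.2]
      rw [Finset.sum_mul, Finset.sum_mul]
      symm
      apply Finset.sum_subset hsub
      intro v hv hv'
      simp only [Finset.mem_Ioo, Finset.mem_range] at hv hv'
      by_cases huv : u ≤ v
      · obtain ⟨c, hc⟩ := C.hom huv (by omega) (by omega) x
        obtain rfl : v = C.n := by omega
        rw [hc, smul_mul_assoc, C.mul (by omega) huv (by omega), h, smul_zero]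
      · rw [C.hom_zero (by omega) (by omega), zero_mul]
    rw [RingHom.id_apply, smul_eq_mul, Finset.mul_sum, Finset.sum_congr rfl hL,
      Finset.sum_congr rfl hR, Finset.sum_comm]
    exact Finset.sum_congr rfl fun u hu => Finset.sum_congr rfl fun v hv => key u hu v hv

lemma dualToProj_apply {a : ℕ} (h : C.q a C.n = 0) (ha : a ≤ C.n) (φ : DualMod k B) :
    C.dualToProj h ha φ = ∑ v ∈ Finset.Ioo a C.n, φ (C.q v C.n) • C.q a v := rfl

/-- The functional `x ↦ g (e * x * f)`. -/
def sandwich (e f : B) (g : DualMod k B) : DualMod k B :=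
  LinearMap.comp (g : B →ₗ[k] k) (LinearMap.comp (LinearMap.mulRight k f) (LinearMap.mulLeft k e))

lemma sandwich_apply (e f : B) (g : DualMod k B) (x : B) : sandwich e f g x = g (e * x * f) := rfl

lemma sandwich_mem (f : B) (g : DualMod k B) :
    sandwich (C.q C.n C.n) f g ∈ injMod k (C.q C.n C.n) := fun x => by
  rw [sandwich_apply, sandwich_apply, ← mul_assoc, C.idem le_rfl]

lemma vertex_smul_sandwich {u : ℕ} (hu : u ≤ C.n) (e : B) (g : DualMod k B) :
    C.q u u • sandwich e (C.q u u) g = sandwich e (C.q u u) g := by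
  ext x
  rw [DualMod.smul_apply, sandwich_apply, sandwich_apply, ← mul_assoc, mul_assoc _ (C.q u u),
    C.idem hu]

lemma path_mul_source {v : ℕ} (hv : v < C.n) (x : B) : C.q v C.n * x * C.q 0 0 = 0 := by
  obtain ⟨c, hc⟩ := C.hom (Nat.zero_le v) hv.le (Or.inr hv) x
  rw [← C.right_id hv.le le_rfl, mul_assoc, mul_assoc, ← mul_assoc (C.q v v), hc, mul_smul_comm,
    C.mul (Nat.zero_le v) hv.le le_rfl, C.zero, smul_zero]

lemma sink_mul_path {v : ℕ} (h0 : 0 < v) (hv : v ≤ C.n) (x : B) :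
    C.q C.n C.n * x * C.q 0 v = 0 := by
  obtain ⟨c, hc⟩ := C.hom hv le_rfl (Or.inl h0) x
  rw [← C.left_id (Nat.zero_le v) hv, ← mul_assoc, hc, smul_mul_assoc,
    C.mul (Nat.zero_le v) hv le_rfl, C.zero, smul_zero]

lemma sandwich_source_apply {v : ℕ} (hv : v < C.n) (g : DualMod k B) (x : B) :
    sandwich (C.q C.n C.n) (C.q 0 0) g (C.q v C.n * x) = 0 := by
  rw [sandwich_apply, mul_assoc, C.path_mul_source hv, mul_zero, map_zero]

lemma path_smul_sandwich_source {v : ℕ} (h0 : 0 < v) (hv : v ≤ C.n) (g : DualMod k B) :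
    C.q 0 v • sandwich (C.q C.n C.n) (C.q 0 0) g = 0 := by
  ext x
  rw [DualMod.smul_apply, sandwich_apply, ← mul_assoc, C.sink_mul_path h0 hv, zero_mul, map_zero,
    DualMod.zero_apply]

lemma exists_source_functional : ∃ g : DualMod k B, sandwich (C.q C.n C.n) (C.q 0 0) g ≠ 0 := by
  obtain ⟨x, hx⟩ := C.nonzero
  obtain ⟨g, hg⟩ := DualMod.exists_apply_ne_zero (k := k) hx
  exact ⟨g, fun h => hg (congrArg (fun φ : DualMod k B => φ x) h)⟩

lemma exists_path_functional {u : ℕ} (hu : u ≤ C.n) (h : C.q u C.n ≠ 0) :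
    ∃ g : DualMod k B, sandwich (C.q C.n C.n) (C.q u u) g (C.q u C.n) ≠ 0 := by
  obtain ⟨g, hg⟩ := DualMod.exists_apply_ne_zero (k := k) h
  refine ⟨g, ?_⟩
  rwa [sandwich_apply, C.left_id hu le_rfl, C.right_id hu le_rfl]

/-- The functionals of the injective module at the sink vanishing on all paths through `v`. -/
def subInj (v : ℕ) : Submodule B (DualMod k B) where
  carrier := {φ | φ ∈ injMod k (C.q C.n C.n) ∧ ∀ x, φ (C.q v C.n * x) = 0}
  add_mem' h h' := ⟨add_mem h.1 h'.1, fun x => by simp [h.2 x, h'.2 x]⟩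
  zero_mem' := ⟨zero_mem _, fun x => by simp⟩
  smul_mem' b φ h := ⟨Submodule.smul_mem _ b h.1, fun x => by simp [mul_assoc, h.2 (x * b)]⟩

lemma subInj_le (v : ℕ) : C.subInj v ≤ injMod k (C.q C.n C.n) := fun _ h => h.1

lemma sandwich_source_mem {v : ℕ} (hv : v < C.n) (g : DualMod k B) :
    sandwich (C.q C.n C.n) (C.q 0 0) g ∈ C.subInj v :=
  ⟨C.sandwich_mem _ g, C.sandwich_source_apply hv g⟩

lemma subInj_ne_bot {v : ℕ} (hv : v < C.n) : C.subInj v ≠ ⊥ := by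
  obtain ⟨g, hg⟩ := C.exists_source_functional
  exact fun h => hg ((Submodule.mem_bot B).1 (h ▸ C.sandwich_source_mem hv g))

lemma indec_subInj {v : ℕ} (hv : v < C.n) : Indec B (ModuleCat.of B (C.subInj v)) :=
  indec_of_le_injMod (C.hom_vertex le_rfl) (C.subInj_le v) (C.subInj_ne_bot hv)

lemma indec_inj : Indec B (ModuleCat.of B (injMod k (C.q C.n C.n))) :=
  indec_of_le_injMod (C.hom_vertex le_rfl) le_rfl fun h =>
    C.subInj_ne_bot C.pos (le_bot_iff.1 (h ▸ C.subInj_le 0))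

lemma mul_vertex_of_mem_ideal_zero {a j : ℕ} (hj : j ≤ C.n) {x : B}
    (hx : x ∈ C.ideal 0 a j) : x * C.q j j = 0 := by
  obtain ⟨y, z, rfl⟩ := Submodule.mem_span_pair.1 hx
  simp [mul_assoc, sub_mul, C.idem hj]

/-- A nontrivial class in the second extension group attached to a zero relation. -/
lemma exists_not_extends {a b : ℕ} (hab : a + 2 ≤ b) (hb : b ≤ C.n) (h0 : C.q a b = 0)
    (h1 : C.q (a + 1) C.n ≠ 0) (h2 : C.q a (b - 1) ≠ 0) :
    ∃ φ : LinearMap.ker (LinearMap.toSpanSingleton B (B ⧸ Submodule.span B {1 - C.q a a})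
      (Submodule.mkQ _ (C.q a (a + 1)))) →ₗ[B] C.subInj (b - 1),
      ¬ ∃ ψ : B →ₗ[B] C.subInj (b - 1), ∀ x, ψ x.1 = φ x := by
  obtain ⟨g, hg⟩ := C.exists_path_functional (by omega) h1
  set z := sandwich (C.q C.n C.n) (C.q (a + 1) (a + 1)) g with hz
  set d := LinearMap.toSpanSingleton B (B ⧸ Submodule.span B {1 - C.q a a})
      (Submodule.mkQ _ (C.q a (a + 1))) with hd
  have hker : ∀ x, x ∈ LinearMap.ker d ↔ x * C.q a (a + 1) = 0 := by
    intro x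
    rw [LinearMap.mem_ker, hd, LinearMap.toSpanSingleton_apply, ← map_smul, smul_eq_mul,
      Submodule.mkQ_apply, Submodule.Quotient.mk_eq_zero]
    refine ⟨fun h => ?_, fun h => h ▸ zero_mem _⟩
    obtain ⟨y, hy⟩ := Submodule.mem_span_singleton.1 h
    rw [← C.right_id (u := a) (v := a + 1) (by omega) (by omega), ← mul_assoc, ← hy]
    simp [mul_assoc, sub_mul, C.idem (u := a) (by omega)]
  have hmem : ∀ x : LinearMap.ker d, x.1 • z ∈ C.subInj (b - 1) := by
    rintro ⟨x, hx⟩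
    rw [hker] at hx
    refine ⟨Submodule.smul_mem _ _ (C.sandwich_mem _ g), fun y => ?_⟩
    obtain ⟨c, hc⟩ := C.hom (u := a + 1) (v := b - 1) (by omega) (by omega) (by omega) (y * x)
    have hc0 : c = 0 := by
      have h3 := congrArg (· * C.q a (a + 1)) hc
      simp only [smul_mul_assoc] at h3
      rw [C.mul (by omega) (by omega) (by omega), mul_assoc, C.left_id (by omega) (by omega),
        mul_assoc, mul_assoc, hx, mul_zero, mul_zero] at h3
      exact (smul_eq_zero.1 h3.symm).resolve_right h2
    have h4 : C.q (b - 1) C.n * y * x * C.q (a + 1) (a + 1) = 0 := by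
      rw [← C.right_id (u := b - 1) (v := C.n) (by omega) le_rfl]
      simp only [mul_assoc] at hc ⊢
      rw [hc, hc0, zero_smul, mul_zero]
    rw [DualMod.smul_apply, hz, sandwich_apply, mul_assoc, h4, mul_zero, map_zero]
  refine ⟨((LinearMap.toSpanSingleton B (DualMod k B) z).domRestrict _).codRestrict _ hmem, ?_⟩
  rintro ⟨ψ, hψ⟩
  have hx : C.q (a + 1) b ∈ LinearMap.ker d := by
    rw [hker, C.mul (by omega) (by omega) hb, h0]
  have h3 : C.q (a + 1) b • (ψ 1).1 = C.q (a + 1) b • z := by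
    have h5 : (ψ (C.q (a + 1) b)).1 = C.q (a + 1) b • z := congrArg Subtype.val (hψ ⟨_, hx⟩)
    rwa [← mul_one (C.q (a + 1) b), ← smul_eq_mul, map_smul, smul_eq_mul, mul_one] at h5
  have h4 := congrArg (fun φ : DualMod k B => φ (C.q b C.n)) h3
  simp only [DualMod.smul_apply] at h4
  rw [C.mul (by omega) (by omega) le_rfl] at h4
  apply hg
  rw [← h4, ← C.mul (u := a + 1) (v := b - 1) (by omega) (by omega) le_rfl]
  exact (ψ 1).2.2 _

variable [FiniteDimensional k B]

lemma fdMod_submodule (N : Submodule B (DualMod k B)) : FdMod B (ModuleCat.of B N) := by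
  have : IsNoetherianRing B := IsNoetherianRing.of_finite k B
  exact inferInstanceAs (Module.Finite B N)

lemma step_proj_subInj {a v : ℕ} (ha : a < C.n) (hv : v < C.n) :
    Step B (ModuleCat.of B (B ⧸ C.ideal 0 a 0)) (ModuleCat.of B (C.subInj v)) := by
  obtain ⟨g, hg⟩ := C.exists_source_functional
  let m : C.subInj v := ⟨_, C.sandwich_source_mem hv g⟩
  refine ⟨C.indec_quotient_ideal (Nat.zero_le a) ha, C.fdMod_quotient_ideal _ _ _,
    C.indec_subInj hv, fdMod_submodule _,
    C.liftIdeal 0 a 0 m (Subtype.ext (C.vertex_smul_sandwich (Nat.zero_le _) _ g)) (by simp),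
    ?_, ?_⟩
  · intro h
    have h1 := LinearMap.congr_fun h ((C.ideal 0 a 0).mkQ 1)
    rw [liftIdeal_mkQ, one_smul] at h1
    exact hg (congrArg Subtype.val h1)
  · rintro ⟨h, -⟩
    have h1 : (C.ideal 0 a 0).mkQ (C.q 0 1) = 0 := by
      apply h
      refine Eq.trans (C.liftIdeal_mkQ _ _ _) (Eq.trans (Subtype.ext ?_) (map_zero _).symm)
      exact C.path_smul_sandwich_source one_pos C.pos g
    apply C.arrow C.pos
    rw [← C.right_id (Nat.zero_le _) C.pos]
    exact C.mul_vertex_of_mem_ideal_zero (Nat.zero_le _) ((Submodule.Quotient.mk_eq_zero _).1 h1)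

lemma step_subInj_inj {u v : ℕ} (huv : u ≤ v) (hv : v < C.n) (hu : C.q u C.n ≠ 0) :
    Step B (ModuleCat.of B (C.subInj v)) (ModuleCat.of B (injMod k (C.q C.n C.n))) := by
  obtain ⟨g, hg⟩ := C.exists_source_functional
  obtain ⟨g', hg'⟩ := C.exists_path_functional (by omega) hu
  refine ⟨C.indec_subInj hv, fdMod_submodule _, C.indec_inj, fdMod_submodule _,
    Submodule.inclusion (C.subInj_le v), ?_, ?_⟩
  · intro h
    have := LinearMap.congr_fun h ⟨_, C.sandwich_source_mem hv g⟩
    exact hg (congrArg Subtype.val this)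
  · rintro ⟨-, h⟩
    obtain ⟨y, hy⟩ := h ⟨_, C.sandwich_mem (C.q u u) g'⟩
    apply hg'
    have h1 := congrArg Subtype.val hy
    rw [← C.mul huv hv.le le_rfl]
    exact (congrArg (fun φ : DualMod k B => φ (C.q v C.n * C.q u v)) h1).symm.trans (y.2.2 _)

lemma step_quotient_inj {a : ℕ} (ha : a + 1 < C.n) (h : C.q (a + 1) C.n ≠ 0) :
    Step B (ModuleCat.of B (B ⧸ C.ideal 1 a 0)) (ModuleCat.of B (injMod k (C.q C.n C.n))) := by
  obtain ⟨g, hg⟩ := C.exists_source_functional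
  obtain ⟨g', hg'⟩ := C.exists_path_functional ha.le h
  let m : injMod k (C.q C.n C.n) := ⟨_, C.sandwich_mem (C.q 0 0) g⟩
  refine ⟨C.indec_quotient_ideal (Nat.zero_le a) (by omega), C.fdMod_quotient_ideal _ _ _,
    C.indec_inj, fdMod_submodule _,
    C.liftIdeal 1 a 0 m (Subtype.ext (C.vertex_smul_sandwich (Nat.zero_le _) _ g)) ?_, ?_, ?_⟩
  · rw [one_mul]
    exact Subtype.ext (C.path_smul_sandwich_source (Nat.succ_pos a) ha.le g)
  · intro h
    have h1 := LinearMap.congr_fun h ((C.ideal 1 a 0).mkQ 1)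
    rw [liftIdeal_mkQ, one_smul] at h1
    exact hg (congrArg Subtype.val h1)
  · rintro ⟨-, h⟩
    obtain ⟨y, hy⟩ := h ⟨_, C.sandwich_mem (C.q (a + 1) (a + 1)) g'⟩
    obtain ⟨y, rfl⟩ := Submodule.mkQ_surjective _ y
    apply hg'
    have h1 := congrArg Subtype.val hy
    exact (congrArg (fun φ : DualMod k B => φ (C.q (a + 1) C.n)) h1).symm.trans
      (C.sandwich_source_apply ha g y)

lemma step_inj_proj {a : ℕ} (ha : a + 1 < C.n) (h0 : C.q a C.n = 0)
    (h : C.q (a + 1) C.n ≠ 0) :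
    Step B (ModuleCat.of B (injMod k (C.q C.n C.n))) (ModuleCat.of B (B ⧸ C.ideal 0 a a)) := by
  obtain ⟨g', hg'⟩ := C.exists_path_functional ha.le h
  have hright : ∀ φ, C.dualToProj h0 (by omega) φ * C.q a a = C.dualToProj h0 (by omega) φ := by
    intro φ
    rw [dualToProj_apply, Finset.sum_mul]
    refine Finset.sum_congr rfl fun v hv => ?_
    simp only [Finset.mem_Ioo] at hv
    rw [smul_mul_assoc, C.right_id hv.1.le hv.2.le]
  refine ⟨C.indec_inj, fdMod_submodule _, C.indec_quotient_ideal le_rfl (by omega),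
    C.fdMod_quotient_ideal _ _ _, ((C.ideal 0 a a).mkQ.comp (C.dualToProj h0 (by omega))).comp
      (Submodule.subtype _), ?_, ?_⟩
  · intro hF
    set φ := sandwich (C.q C.n C.n) (C.q (a + 1) (a + 1)) g' with hφ
    have h1 : (C.ideal 0 a a).mkQ (C.dualToProj h0 (by omega) φ) = 0 :=
      LinearMap.congr_fun hF ⟨φ, C.sandwich_mem _ g'⟩
    have h2 := C.mul_vertex_of_mem_ideal_zero (by omega) ((Submodule.Quotient.mk_eq_zero _).1 h1)
    rw [hright] at h2
    have h3 := congrArg (C.q (a + 1) (a + 1) * ·) h2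
    simp only [mul_zero] at h3
    rw [dualToProj_apply, Finset.mul_sum, Finset.sum_eq_single (a + 1)] at h3
    · rw [mul_smul_comm, C.left_id (by omega) (by omega)] at h3
      exact (smul_ne_zero hg' (C.arrow (by omega))) h3
    · intro v hv hv'
      simp only [Finset.mem_Ioo] at hv
      rw [mul_smul_comm, ← C.left_id hv.1.le hv.2.le, ← mul_assoc,
        ← mul_one (C.q (a + 1) (a + 1)), C.hom_zero (by omega) (by omega), zero_mul, smul_zero]
    · intro hn
      exact absurd (Finset.mem_Ioo.2 ⟨by omega, ha⟩) hn
  · rintro ⟨-, hs⟩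
    obtain ⟨φ, hφ⟩ := hs ((C.ideal 0 a a).mkQ 1)
    have h1 := C.mul_vertex_of_mem_ideal_zero (by omega) ((Submodule.Quotient.eq _).1 hφ)
    simp only [sub_mul, one_mul] at h1
    have h2 := congrArg (C.q a a * ·) h1
    simp only [mul_sub, mul_zero] at h2
    change C.q a a * (C.dualToProj h0 _ φ.1 * C.q a a) - _ = 0 at h2
    rw [hright, C.idem (by omega), dualToProj_apply, Finset.mul_sum, Finset.sum_eq_zero] at h2
    · exact C.vertex_ne_zero (u := a) (by omega) (by simpa using h2)
    · intro v hv
      simp only [Finset.mem_Ioo] at hv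
      rw [mul_smul_comm, ← one_mul (C.q a v), C.vertex_mul_path (by omega) (by omega), smul_zero]

theorem not_weaklyShod (C : ZeroChain k B) : ¬ WeaklyShod B := by
  obtain ⟨a, b, hab, hb, han, h0, h1, h2⟩ := C.exists_last_relation
  have hab' : a + 1 < C.n := by omega
  obtain ⟨φ, hφ⟩ := C.exists_not_extends hab hb h0 h1 h2
  have hproj := projective_quotient (C.idem (u := a) (by omega))
  have hXI : IndPath B (ModuleCat.of B (B ⧸ C.ideal 1 a a))
      (ModuleCat.of B (injMod k (C.q C.n C.n))) :=
    (C.indPath_quotient le_rfl (by omega)).tail (C.step_quotient_inj hab' h1)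
  have hIY : IndPath B (ModuleCat.of B (injMod k (C.q C.n C.n)))
      (ModuleCat.of B (C.subInj (b - 1))) :=
    ((C.indPath_quotient le_rfl (by omega)).tail
      (C.step_proj_subInj (by omega) (by omega))).head (C.step_inj_proj hab' han h1)
  have hYI := C.step_subInj_inj (u := a + 1) (v := b - 1) (by omega) (by omega) h1
  intro hws
  refine hws (ModuleCat.of B (C.subInj (b - 1))) (C.indec_subInj (by omega)) (fdMod_submodule _)
    (fun hL => ?_) (fun hR => ?_) (Relation.TransGen.head' hYI hIY)
  · have hpd := hL.2.2 _ (C.indec_quotient_ideal le_rfl (by omega)) (C.fdMod_quotient_ideal _ _ _)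
      (hXI.trans hIY)
    have hle : Submodule.span B {1 - C.q a a} ≤ C.ideal 1 a a :=
      Submodule.span_mono (by simp)
    refine hφ (hpd.exists_extension _ (Submodule.factor hle) (Submodule.factor_surjective hle)
      ?_ φ)
    ext x
    obtain ⟨x, rfl⟩ := Submodule.mkQ_surjective _ x
    have h3 : x ∈ C.ideal 1 a a ↔ Submodule.mkQ (Submodule.span B {1 - C.q a a}) x ∈
        LinearMap.range (LinearMap.toSpanSingleton B (B ⧸ Submodule.span B {1 - C.q a a})
          (Submodule.mkQ _ (C.q a (a + 1)))) := by
      rw [ideal, Submodule.mem_span_pair, LinearMap.mem_range]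
      constructor
      · rintro ⟨y, z, rfl⟩
        refine ⟨z, ?_⟩
        rw [LinearMap.toSpanSingleton_apply, ← map_smul]
        exact (Submodule.Quotient.eq _).2 (Submodule.mem_span_singleton.2 ⟨-y, by simp⟩)
      · rintro ⟨z, hz⟩
        rw [LinearMap.toSpanSingleton_apply, ← map_smul] at hz
        obtain ⟨y, hy⟩ := Submodule.mem_span_singleton.1 ((Submodule.Quotient.eq _).1 hz)
        refine ⟨-y, z, ?_⟩
        simp only [smul_eq_mul, one_mul] at hy ⊢
        rw [neg_mul, hy]; abel
    rw [← h3, LinearMap.mem_ker]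
    exact (Submodule.Quotient.mk_eq_zero _).symm
  · exact hφ ((hR.2.2 _ hR.1 hR.2.1 .refl).exists_extension _ φ)

end ZeroChain
end Abstract
end Toupie

namespace Toupie

section Paths

variable {k : Type u} [Field k] {t : ℕ} {ℓ : Fin t → ℕ}

instance : Finite (Vtx t ℓ) := by
  refine Finite.of_injective (β := Option (Option (Σ i : Fin t, Fin (ℓ i - 1))))
    (fun v => match v with
      | .src => none
      | .snk => some none
      | .mid i a => some (some ⟨i, a⟩)) ?_
  rintro (_ | _ | ⟨i, a⟩) (_ | _ | ⟨j, b⟩) h <;> simp_all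

instance : Finite (PIdx t ℓ) := by
  refine Finite.of_injective (β := Vtx t ℓ ⊕ Σ i : Fin t, Fin (ℓ i + 1) × Fin (ℓ i + 1))
    (fun p => match p with
      | .vert v => Sum.inl v
      | .sub i a b hab hb => Sum.inr ⟨i, ⟨a, by omega⟩, ⟨b, by omega⟩⟩) ?_
  rintro (v | ⟨i, a, b, h1, h2⟩) (w | ⟨j, c, d, h3, h4⟩) h
  · simpa using h
  · simp at h
  · simp at h
  · simp only [Sum.inr.injEq, Sigma.mk.injEq] at h
    obtain ⟨rfl, h⟩ := h
    simp only [heq_eq_eq, Prod.mk.injEq, Fin.mk.injEq] at h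
    obtain ⟨rfl, rfl⟩ := h
    rfl

instance : FiniteDimensional k (PathAlg k t ℓ) :=
  inferInstanceAs (FiniteDimensional k (Subalgebra.toSubmodule (PathAlg k t ℓ)))

lemma vtx_eq_vtx (hℓ : ∀ i, 1 ≤ ℓ i) {i j : Fin t} {a b : ℕ} (ha : a ≤ ℓ i) (hb : b ≤ ℓ j)
    (h : vtx t ℓ i a = vtx t ℓ j b) :
    (a = 0 ∧ b = 0) ∨ (a = ℓ i ∧ b = ℓ j) ∨ (i = j ∧ a = b) := by
  have hi := hℓ i
  have hj := hℓ j
  unfold vtx at h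
  split_ifs at h with h1 h2 h3 h4 h5 h6
  · exact Or.inl ⟨h1, h2⟩
  · simp only [Vtx.mid.injEq] at h
    obtain ⟨rfl, h⟩ := h
    simp only [heq_eq_eq, Fin.mk.injEq] at h
    exact Or.inr (Or.inr ⟨rfl, by omega⟩)
  · exact Or.inr (Or.inl ⟨by omega, by omega⟩)

lemma vtx_injOn (hℓ : ∀ i, 1 ≤ ℓ i) {i : Fin t} {a b : ℕ} (ha : a ≤ ℓ i) (hb : b ≤ ℓ i) :
    vtx t ℓ i a = vtx t ℓ i b ↔ a = b := by
  refine ⟨fun h => ?_, fun h => h ▸ rfl⟩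
  have := vtx_eq_vtx hℓ ha hb h
  omega

lemma startIdx_strip {i : Fin t} {j : ℕ} {p q : PIdx t ℓ} (h : strip i j p = some q) :
    startIdx p = vtx t ℓ i j ∧ startIdx q = vtx t ℓ i (j + 1) ∧ j < ℓ i := by
  rcases p with v | ⟨i', a, b, hab, hb⟩
  · simp [strip] at h
  · dsimp only [strip] at h
    split_ifs at h with h1 h2
    · obtain ⟨rfl, rfl⟩ := h1
      cases h
      exact ⟨rfl, rfl, by omega⟩
    · obtain ⟨rfl, rfl⟩ := h1
      cases h
      obtain rfl : b = a + 1 := by omega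
      exact ⟨rfl, rfl, by omega⟩

lemma eV_mul_eV (u v : Vtx t ℓ) :
    (eV u * eV v : PathAlg k t ℓ) = if u = v then eV u else 0 := by
  refine Subtype.ext (LinearMap.ext fun f => funext fun p => ?_)
  change (if startIdx p = u then (if startIdx p = v then f p else 0) else 0) = _
  split_ifs with h1 h2 h3 h3 h3
  · change _ = if startIdx p = u then f p else 0
    rw [if_pos h1]
  · exact absurd (h1.symm.trans h2) h3
  · exact absurd (h1.trans h3) h2
  · rfl
  · change _ = if startIdx p = u then f p else 0
    rw [if_neg h1]
  · rfl

lemma eV_mul_arE (u : Vtx t ℓ) (i : Fin t) (j : ℕ) :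
    (eV u * arE i j : PathAlg k t ℓ) = if u = vtx t ℓ i j then arE i j else 0 := by
  refine Subtype.ext (LinearMap.ext fun f => funext fun p => ?_)
  have hR : ((if u = vtx t ℓ i j then arE i j else 0 : PathAlg k t ℓ).1 f) p =
      if u = vtx t ℓ i j then (strip i j p).elim 0 f else 0 := by
    split_ifs <;> rfl
  rw [hR]
  change (if startIdx p = u then (strip i j p).elim 0 f else 0) = _
  rcases h : strip i j p with _ | q
  · simp
  · rw [(startIdx_strip h).1]
    simp only [eq_comm]

lemma arE_mul_eV (u : Vtx t ℓ) (i : Fin t) (j : ℕ) :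
    (arE i j * eV u : PathAlg k t ℓ) = if u = vtx t ℓ i (j + 1) then arE i j else 0 := by
  refine Subtype.ext (LinearMap.ext fun f => funext fun p => ?_)
  have hR : ((if u = vtx t ℓ i (j + 1) then arE i j else 0 : PathAlg k t ℓ).1 f) p =
      if u = vtx t ℓ i (j + 1) then (strip i j p).elim 0 f else 0 := by
    split_ifs <;> rfl
  rw [hR]
  change (strip i j p).elim 0 (Ev k u f) = _
  rcases h : strip i j p with _ | q
  · simp
  · change (if startIdx q = u then f q else 0) = _
    rw [(startIdx_strip h).2.1]
    simp only [eq_comm]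
    rfl

lemma arE_eq_zero {i : Fin t} {j : ℕ} (h : ℓ i ≤ j) : (arE i j : PathAlg k t ℓ) = 0 := by
  refine Subtype.ext (LinearMap.ext fun f => funext fun p => ?_)
  change (strip i j p).elim 0 f = 0
  rcases hs : strip i j p with _ | q
  · rfl
  · have := (startIdx_strip hs).2.2
    omega

lemma subE_self (i : Fin t) (a : ℕ) : (subE i a a : PathAlg k t ℓ) = 1 := by
  simp [subE]

lemma subE_succ (i : Fin t) {a b : ℕ} (h : a ≤ b) :
    (subE i a (b + 1) : PathAlg k t ℓ) = subE i a b * arE i b := by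
  rw [subE, subE, show b + 1 - a = (b - a) + 1 by omega, List.range_succ]
  simp [Nat.add_sub_cancel' h]

lemma subE_eq_mul (i : Fin t) {a b : ℕ} (h : a + 2 ≤ b) :
    ∃ x : PathAlg k t ℓ, subE i a b = arE i a * (arE i (a + 1) * x) := by
  induction b, h using Nat.le_induction with
  | base => exact ⟨1, by rw [subE_succ i (by omega), subE_succ i le_rfl, subE_self]; simp⟩
  | succ b hb ih =>
    obtain ⟨x, hx⟩ := ih
    exact ⟨x * arE i b, by rw [subE_succ i (by omega), hx]; simp only [mul_assoc]⟩

/-- The path from the `a`-th to the `b`-th vertex of branch `i`, which for `a = b` is the trivial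
path. -/
def pathE (i : Fin t) (a b : ℕ) : PathAlg k t ℓ := eV (vtx t ℓ i a) * subE i a b

lemma pathE_self (i : Fin t) (a : ℕ) : (pathE i a a : PathAlg k t ℓ) = eV (vtx t ℓ i a) := by
  rw [pathE, subE_self, mul_one]

lemma pathE_succ (i : Fin t) {a b : ℕ} (h : a ≤ b) :
    (pathE i a (b + 1) : PathAlg k t ℓ) = pathE i a b * arE i b := by
  rw [pathE, subE_succ i h, ← mul_assoc, pathE]

lemma arE_eq_pathE (i : Fin t) (a : ℕ) : (arE i a : PathAlg k t ℓ) = pathE i a (a + 1) := by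
  rw [pathE_succ i le_rfl, pathE_self, eV_mul_arE, if_pos rfl]

lemma eV_mul_pathE (u : Vtx t ℓ) (i : Fin t) (a b : ℕ) :
    (eV u * pathE i a b : PathAlg k t ℓ) = if u = vtx t ℓ i a then pathE i a b else 0 := by
  rw [pathE, ← mul_assoc, eV_mul_eV]
  split_ifs with h
  · rw [h]
  · rw [zero_mul]

lemma pathE_mul_eV (u : Vtx t ℓ) (i : Fin t) {a b : ℕ} (h : a ≤ b) :
    (pathE i a b * eV u : PathAlg k t ℓ) = if u = vtx t ℓ i b then pathE i a b else 0 := by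
  rcases h.eq_or_lt with rfl | h
  · rw [pathE_self, eV_mul_eV]
    simp only [eq_comm]
  · obtain ⟨b, rfl⟩ : ∃ c, b = c + 1 := ⟨b - 1, by omega⟩
    rw [pathE_succ i (by omega), mul_assoc, arE_mul_eV]
    split_ifs <;> simp

lemma pathE_mul_pathE (i : Fin t) {a b c : ℕ} (hab : a ≤ b) (hbc : b ≤ c) :
    (pathE i a b * pathE i b c : PathAlg k t ℓ) = pathE i a c := by
  induction c, hbc using Nat.le_induction with
  | base => rw [pathE_self, pathE_mul_eV _ _ hab, if_pos rfl]
  | succ c hc ih => rw [pathE_succ i hc, ← mul_assoc, ih, ← pathE_succ i (by omega)]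

variable (k t ℓ) in
/-- The trivial paths and the paths along the branches. -/
def paths : Set (PathAlg k t ℓ) :=
  Set.range eV ∪ {x | ∃ i a b, a < b ∧ b ≤ ℓ i ∧ x = pathE i a b}

lemma sum_eV [Fintype (Vtx t ℓ)] : ∑ v : Vtx t ℓ, (eV v : PathAlg k t ℓ) = 1 := by
  refine Subtype.ext (LinearMap.ext fun f => funext fun p => ?_)
  rw [AddSubmonoidClass.coe_finsetSum, LinearMap.sum_apply, Finset.sum_apply]
  change ∑ v, (if startIdx p = v then f p else 0) = f p
  simp

lemma mul_arE_mem_span (hℓ : ∀ i, 1 ≤ ℓ i) {s : PathAlg k t ℓ} (hs : s ∈ paths k t ℓ)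
    (i : Fin t) (j : ℕ) : s * arE i j ∈ Submodule.span k (paths k t ℓ) := by
  rcases le_or_gt (ℓ i) j with hj | hj
  · rw [arE_eq_zero hj, mul_zero]
    exact zero_mem _
  obtain ⟨v, rfl⟩ | ⟨i', a, b, hab, hb, rfl⟩ := hs
  · rw [eV_mul_arE]
    split_ifs
    · exact Submodule.subset_span (Or.inr ⟨i, j, j + 1, by omega, hj, arE_eq_pathE i j⟩)
    · exact zero_mem _
  · have h1 : (pathE i' a b : PathAlg k t ℓ) = pathE i' a b * eV (vtx t ℓ i' b) := by
      rw [pathE_mul_eV _ _ hab.le, if_pos rfl]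
    rw [h1, mul_assoc, eV_mul_arE]
    split_ifs with h
    · have := hℓ i
      rcases vtx_eq_vtx hℓ hb hj.le h with h2 | h2 | ⟨rfl, rfl⟩
      · omega
      · omega
      · rw [← pathE_succ _ hab.le]
        exact Submodule.subset_span (Or.inr ⟨i', a, b + 1, by omega, hj, rfl⟩)
    · rw [mul_zero]
      exact zero_mem _

lemma mul_eV_mem_span {s : PathAlg k t ℓ} (hs : s ∈ paths k t ℓ) (u : Vtx t ℓ) :
    s * eV u ∈ Submodule.span k (paths k t ℓ) := by
  obtain ⟨v, rfl⟩ | ⟨i, a, b, hab, hb, rfl⟩ := hs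
  · rw [eV_mul_eV]
    split_ifs
    · exact Submodule.subset_span (Or.inl ⟨v, rfl⟩)
    · exact zero_mem _
  · rw [pathE_mul_eV _ _ hab.le]
    split_ifs
    · exact Submodule.subset_span (Or.inr ⟨i, a, b, hab, hb, rfl⟩)
    · exact zero_mem _

lemma span_paths (hℓ : ∀ i, 1 ≤ ℓ i) (x : PathAlg k t ℓ) :
    x ∈ Submodule.span k (paths k t ℓ) := by
  have key : ∀ y (hy : y ∈ PathAlg k t ℓ), ∀ s ∈ Submodule.span k (paths k t ℓ),
      s * ⟨y, hy⟩ ∈ Submodule.span k (paths k t ℓ) := by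
    intro y hy
    refine Algebra.adjoin_induction (p := fun y hy => ∀ s ∈ Submodule.span k (paths k t ℓ),
      s * (⟨y, hy⟩ : PathAlg k t ℓ) ∈ Submodule.span k (paths k t ℓ)) ?_ ?_ ?_ ?_ hy
    · intro y hy s hs
      induction hs using Submodule.span_induction with
      | mem s hs =>
        obtain ⟨v, rfl⟩ | ⟨i, j, rfl⟩ := hy
        · exact mul_eV_mem_span hs v
        · exact mul_arE_mem_span hℓ hs i j
      | zero => rw [zero_mul]; exact zero_mem _
      | add a b _ _ ha hb => rw [add_mul]; exact add_mem ha hb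
      | smul c a _ ha => rw [smul_mul_assoc]; exact Submodule.smul_mem _ c ha
    · intro c s hs
      have : s * algebraMap k (PathAlg k t ℓ) c ∈ Submodule.span k (paths k t ℓ) := by
        rw [← Algebra.commutes, ← Algebra.smul_def]
        exact Submodule.smul_mem _ c hs
      exact this
    · intro a b ha hb iha ihb s hs
      have := add_mem (iha s hs) (ihb s hs)
      rwa [← mul_add] at this
    · intro a b ha hb iha ihb s hs
      have := ihb _ (iha s hs)
      rwa [mul_assoc] at this
  have := Fintype.ofFinite (Vtx t ℓ)
  rw [← one_mul x]
  refine key x.1 x.2 1 ?_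
  rw [← sum_eV]
  exact Submodule.sum_mem _ fun v _ => Submodule.subset_span (Or.inl ⟨v, rfl⟩)

lemma eV_mul_mul_eV_of_pathE (hℓ : ∀ i, 1 ≤ ℓ i) {i i' : Fin t} {u v a b : ℕ} (hu : u ≤ ℓ i)
    (hv : v ≤ ℓ i) (huv : 0 < u ∨ v < ℓ i) (hab : a < b) (hb : b ≤ ℓ i') :
    (eV (vtx t ℓ i u) * pathE i' a b * eV (vtx t ℓ i v) : PathAlg k t ℓ) = 0 ∨
      (i' = i ∧ a = u ∧ b = v) := by
  rw [eV_mul_pathE]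
  split_ifs with h1
  · rw [pathE_mul_eV _ _ hab.le]
    split_ifs with h2
    · right
      have h3 := vtx_eq_vtx hℓ hu (by omega) h1
      have h4 := vtx_eq_vtx hℓ hv hb h2
      have hii : i' = i := by
        by_contra hne
        have hne' : i ≠ i' := fun h => hne h.symm
        simp only [hne', false_and, or_false] at h3 h4
        omega
      subst hii
      exact ⟨rfl, by omega, by omega⟩
    · exact Or.inl rfl
  · rw [zero_mul]
    exact Or.inl rfl

lemma exists_eV_mul_mul_eV (hℓ : ∀ i, 1 ≤ ℓ i) {i : Fin t} {u v : ℕ} (hle : u ≤ v)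
    (hv : v ≤ ℓ i) (huv : 0 < u ∨ v < ℓ i) (x : PathAlg k t ℓ) :
    ∃ c : k, eV (vtx t ℓ i u) * x * eV (vtx t ℓ i v) = c • pathE i u v := by
  induction span_paths hℓ x using Submodule.span_induction with
  | mem s hs =>
    obtain ⟨w, rfl⟩ | ⟨i', a, b, hab, hb, rfl⟩ := hs
    · rw [eV_mul_eV]
      split_ifs with h
      · rw [eV_mul_eV]
        split_ifs with h'
        · obtain rfl := (vtx_injOn hℓ (by omega) hv).1 h'
          exact ⟨1, by rw [pathE_self, one_smul]⟩
        · exact ⟨0, by rw [zero_smul]⟩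
      · exact ⟨0, by rw [zero_smul, zero_mul]⟩
    · rcases eV_mul_mul_eV_of_pathE (k := k) hℓ (by omega) hv huv hab hb with h | ⟨rfl, rfl, rfl⟩
      · exact ⟨0, by rw [h, zero_smul]⟩
      · refine ⟨1, ?_⟩
        rw [eV_mul_pathE, if_pos rfl, pathE_mul_eV _ _ hle, if_pos rfl, one_smul]
  | zero => exact ⟨0, by simp⟩
  | add x y _ _ hx hy =>
    obtain ⟨c, hc⟩ := hx
    obtain ⟨d, hd⟩ := hy
    exact ⟨c + d, by rw [mul_add, add_mul, hc, hd, add_smul]⟩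
  | smul r x _ hx =>
    obtain ⟨c, hc⟩ := hx
    exact ⟨r * c, by rw [mul_smul_comm, smul_mul_assoc, hc, smul_smul]⟩

lemma eV_mul_mul_eV_eq_zero (hℓ : ∀ i, 1 ≤ ℓ i) {i : Fin t} {u v : ℕ} (hlt : v < u)
    (hu : u ≤ ℓ i) (x : PathAlg k t ℓ) :
    eV (vtx t ℓ i u) * x * eV (vtx t ℓ i v) = 0 := by
  induction span_paths hℓ x using Submodule.span_induction with
  | mem s hs =>
    obtain ⟨w, rfl⟩ | ⟨i', a, b, hab, hb, rfl⟩ := hs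
    · rw [eV_mul_eV]
      split_ifs with h
      · rw [eV_mul_eV, if_neg]
        rw [vtx_injOn hℓ hu (by omega)]
        omega
      · rw [zero_mul]
    · rcases eV_mul_mul_eV_of_pathE (k := k) hℓ hu (v := v) (by omega) (by omega) hab hb with
        h | ⟨rfl, rfl, rfl⟩
      · exact h
      · omega
  | zero => simp
  | add x y _ _ hx hy => rw [mul_add, add_mul, hx, hy, add_zero]
  | smul r x _ hx => rw [mul_smul_comm, smul_mul_assoc, hx, smul_zero]

lemma sum_eV_mul (hℓ : ∀ i, 1 ≤ ℓ i) {i : Fin t} {w : ℕ} (hw : w ≤ ℓ i) {y : PathAlg k t ℓ}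
    (h : eV (vtx t ℓ i w) * y = y) :
    ∑ u ∈ Finset.range (ℓ i + 1), eV (vtx t ℓ i u) * y = y := by
  rw [Finset.sum_eq_single w, h]
  · intro u hu hne
    rw [← h, ← mul_assoc, eV_mul_eV, if_neg, zero_mul]
    rwa [vtx_injOn hℓ (by simpa [Nat.lt_succ_iff] using hu) hw]
  · intro hn
    exact absurd (Finset.mem_range.2 (by omega)) hn

lemma sum_mul_eV (hℓ : ∀ i, 1 ≤ ℓ i) {i : Fin t} {w : ℕ} (hw : w ≤ ℓ i) {y : PathAlg k t ℓ}
    (h : y * eV (vtx t ℓ i w) = y) :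
    ∑ u ∈ Finset.range (ℓ i + 1), y * eV (vtx t ℓ i u) = y := by
  rw [Finset.sum_eq_single w, h]
  · intro u hu hne
    rw [← h, mul_assoc, eV_mul_eV, if_neg, mul_zero]
    rw [vtx_injOn hℓ hw (by simpa [Nat.lt_succ_iff] using hu)]
    exact hne.symm
  · intro hn
    exact absurd (Finset.mem_range.2 (by omega)) hn

lemma mul_eV_eq_sum (hℓ : ∀ i, 1 ≤ ℓ i) {i : Fin t} {v : ℕ} (h0 : 0 < v) (hv : v < ℓ i)
    (x : PathAlg k t ℓ) : x * eV (vtx t ℓ i v) =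
      ∑ u ∈ Finset.range (ℓ i + 1), eV (vtx t ℓ i u) * (x * eV (vtx t ℓ i v)) := by
  induction span_paths hℓ x using Submodule.span_induction with
  | mem s hs =>
    obtain ⟨w, rfl⟩ | ⟨i', a, b, hab, hb, rfl⟩ := hs
    · rw [eV_mul_eV]
      split_ifs with h
      · exact (sum_eV_mul hℓ hv.le (by rw [h, eV_mul_eV, if_pos rfl])).symm
      · simp
    · rw [pathE_mul_eV _ _ hab.le]
      split_ifs with h
      · rcases vtx_eq_vtx hℓ hv.le hb h with h | h | ⟨rfl, rfl⟩
        · omega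
        · omega
        · exact (sum_eV_mul hℓ (w := a) (by omega) (by rw [eV_mul_pathE, if_pos rfl])).symm
      · simp
  | zero => simp
  | add x y _ _ hx hy => simp only [add_mul, mul_add, Finset.sum_add_distrib, ← hx, ← hy]
  | smul r x _ hx => simp only [smul_mul_assoc, mul_smul_comm, ← Finset.smul_sum, ← hx]

lemma eV_mul_eq_sum (hℓ : ∀ i, 1 ≤ ℓ i) {i : Fin t} {u : ℕ} (h0 : 0 < u) (hu : u < ℓ i)
    (x : PathAlg k t ℓ) : eV (vtx t ℓ i u) * x =
      ∑ v ∈ Finset.range (ℓ i + 1), eV (vtx t ℓ i u) * x * eV (vtx t ℓ i v) := by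
  induction span_paths hℓ x using Submodule.span_induction with
  | mem s hs =>
    obtain ⟨w, rfl⟩ | ⟨i', a, b, hab, hb, rfl⟩ := hs
    · rw [eV_mul_eV]
      split_ifs with h
      · exact (sum_mul_eV hℓ hu.le (by rw [eV_mul_eV, if_pos rfl])).symm
      · simp
    · rw [eV_mul_pathE]
      split_ifs with h
      · rcases vtx_eq_vtx hℓ hu.le (by omega) h with h | h | ⟨rfl, rfl⟩
        · omega
        · omega
        · exact (sum_mul_eV hℓ (w := b) (by omega)
            (by rw [pathE_mul_eV _ _ hab.le, if_pos rfl])).symm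
      · simp
  | zero => simp
  | add x y _ _ hx hy => simp only [add_mul, mul_add, Finset.sum_add_distrib, ← hx, ← hy]
  | smul r x _ hx => simp only [smul_mul_assoc, mul_smul_comm, ← Finset.smul_sum, ← hx]

/-- The coefficient of the arrow `arE i j` in an element of the path algebra. -/
def arrowCoeff (i : Fin t) (j : ℕ) (hj : j < ℓ i) : PathAlg k t ℓ →ₗ[k] k where
  toFun x := x.1 (fun p => match p with
    | .vert _ => 1
    | .sub _ _ _ _ _ => 0) (.sub i j (j + 1) (Nat.lt_succ_self j) hj)
  map_add' _ _ := rfl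
  map_smul' _ _ := rfl

lemma arrowCoeff_arE {i : Fin t} {j : ℕ} (hj : j < ℓ i) :
    arrowCoeff (k := k) i j hj (arE i j) = 1 := by
  change (strip i j (.sub i j (j + 1) (Nat.lt_succ_self j) hj)).elim 0 _ = _
  simp [strip]

lemma arrowCoeff_mul_mul {i i' : Fin t} {j a b : ℕ} (hj : j < ℓ i) (x : PathAlg k t ℓ) :
    arrowCoeff (k := k) i j hj (arE i' a * (arE i' b * x)) = 0 := by
  change (strip i' a (.sub i j (j + 1) (Nat.lt_succ_self j) hj)).elim 0
    (fun p => (strip i' b p).elim 0 _) = _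
  dsimp only [strip]
  split_ifs with h h'
  · omega
  · rfl
  · rfl

end Paths

section ToupieAlg

variable {k : Type u} [Field k] (T : ToupieAlg k)

lemma mkA_smul (c : k) (x : PathAlg k T.t T.ℓ) : mkA T (c • x) = c • mkA T x := by
  rw [Algebra.smul_def, Algebra.smul_def, map_mul]
  rfl

lemma mkA_eq_zero_iff (x : PathAlg k T.t T.ℓ) : mkA T x = 0 ↔ x ∈ T.I := by
  rw [TwoSidedIdeal.mem_iff, ← map_zero (mkA T)]
  exact RingCon.eq _

instance : FiniteDimensional k (Alg T) :=
  Module.Finite.of_surjective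
    ({ toFun := mkA T, map_add' := map_add _, map_smul' := mkA_smul T } :
      PathAlg k T.t T.ℓ →ₗ[k] Alg T) (mkA_surjective T)

lemma arE_notMem {i : Fin T.t} {j : ℕ} (hj : j < T.ℓ i) : arE i j ∉ T.I := by
  intro h
  have hle : Submodule.span k {y : PathAlg k T.t T.ℓ | ∃ i a b, a + 2 ≤ b ∧ b ≤ T.ℓ i ∧
      y = subE i a b} ≤ LinearMap.ker (arrowCoeff (k := k) i j hj) := by
    rw [Submodule.span_le]
    rintro _ ⟨i', a, b, hab, -, rfl⟩
    obtain ⟨x, hx⟩ := subE_eq_mul (k := k) (ℓ := T.ℓ) i' hab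
    rw [hx]
    exact arrowCoeff_mul_mul hj x
  have h1 := hle (T.adm _ h)
  rw [LinearMap.mem_ker, arrowCoeff_arE] at h1
  exact one_ne_zero h1

/-- A branch in the ideal of a toupie algebra, as a chain in the opposite algebra. -/
def zeroChain {i : Fin T.t} (hi : branchInI T i) (hm : mDim T = 1) :
    ZeroChain k (Alg T)ᵐᵒᵖ where
  n := T.ℓ i
  q u v := op (mkA T (pathE i u v))
  mul huv hvw _ := by rw [← op_mul, ← map_mul, pathE_mul_pathE i huv hvw]
  arrow {u} hu := by
    rw [Ne, op_eq_zero_iff, mkA_eq_zero_iff, ← arE_eq_pathE]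
    exact arE_notMem T hu
  hom {u v} huv hv h x := by
    obtain ⟨x, rfl⟩ := op_surjective x
    obtain ⟨x, rfl⟩ := mkA_surjective T x
    obtain ⟨c, hc⟩ := exists_eV_mul_mul_eV T.hℓ huv hv h x
    refine ⟨c, ?_⟩
    rw [← op_mul, ← op_mul, ← map_mul, ← map_mul, pathE_self, pathE_self, ← mul_assoc, hc, mkA_smul,
      op_smul]
  hom_zero {u v} huv hv x := by
    obtain ⟨x, rfl⟩ := op_surjective x
    obtain ⟨x, rfl⟩ := mkA_surjective T x
    rw [← op_mul, ← op_mul, ← map_mul, ← map_mul, pathE_self, pathE_self, ← mul_assoc,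
      eV_mul_mul_eV_eq_zero T.hℓ huv hv, map_zero, op_zero]
  row {v} h0 hv x := by
    obtain ⟨x, rfl⟩ := op_surjective x
    obtain ⟨x, rfl⟩ := mkA_surjective T x
    simp only [← op_mul, ← map_mul, pathE_self]
    rw [← Finset.op_sum, ← map_sum, ← mul_eV_eq_sum T.hℓ h0 hv]
  col {u} h0 hu x := by
    obtain ⟨x, rfl⟩ := op_surjective x
    obtain ⟨x, rfl⟩ := mkA_surjective T x
    simp only [← op_mul, ← map_mul, pathE_self, ← mul_assoc]
    rw [← Finset.op_sum, ← map_sum, ← eV_mul_eq_sum T.hℓ h0 hu]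
  zero := by
    rw [op_eq_zero_iff, mkA_eq_zero_iff]
    exact T.I.mul_mem_left _ _ hi
  nonzero := by
    by_contra! h
    have h0 : lrMap T = 0 := by
      refine LinearMap.ext fun x => ?_
      have := h (op x)
      rw [pathE_self, pathE_self, ← op_mul, ← op_mul, op_eq_zero_iff, ← mul_assoc] at this
      have hs : vtx T.t T.ℓ i (T.ℓ i) = .snk := by
        have := T.hℓ i
        rw [vtx, if_neg (by omega), dif_neg (by omega)]
      rwa [hs] at this
    rw [mDim, h0, LinearMap.range_zero, finrank_bot] at hm
    exact zero_ne_one hm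

end ToupieAlg

/-- A non simply connected toupie algebra with
`m = dim_k e₀ A e∞ = 1`, some branch of which lies in the ideal `I`, is not weakly
shod. -/
theorem not_weaklyShod_of_branch_in_ideal_of_mDim_one {k : Type u} [Field k]
    (T : ToupieAlg k) (hnsc : ¬ SimplyConnected T) (hm : mDim T = 1)
    (hb : ∃ i : Fin T.t, branchInI T i) :
    ¬ WeaklyShod (Alg T)ᵐᵒᵖ := by
  obtain ⟨i, hi⟩ := hb
  have : FiniteDimensional k (Alg T)ᵐᵒᵖ := Module.Finite.equiv (opLinearEquiv k)
  exact (zeroChain T hi hm).not_weaklyShod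

end Toupie
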